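/- arXiv:1906.05524 — 5 statements merged into one kernel-verified Lean document; each statement's English description precedes it below -/
import Mathlib

section
/- Let N ≥ 2 and 0 < s < 1/2. Then the fractional isoperimetric quotient of the unit ball B_1 ⊂ ℝ^N satisfies P_s(B_1) / |B_1|^((N-2s)/N) = N · π^(N/2 + s) · Γ(1-2s) / ( s · Γ(N/2 + 1)^(2s/N) · Γ(1-s) · Γ((N+2-2s)/2) ). -/
open MeasureTheory Real
open scoped ENNReal

/-- The fractional `s`-perimeter of a set `E ⊆ ℝ^N`:
`P_s(E) = ∫∫ |1_E(x) - 1_E(y)|² / |x-y|^(N+2s) dx dy`, as an element of `[0,∞]`. -/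
noncomputable def fracPerimeter (N : ℕ) (s : ℝ) (E : Set (EuclideanSpace ℝ (Fin N))) : ℝ≥0∞ :=
  ∫⁻ x, ∫⁻ y, ENNReal.ofReal
    (|E.indicator (fun _ => (1 : ℝ)) x - E.indicator (fun _ => (1 : ℝ)) y| ^ 2
      / ‖x - y‖ ^ ((N : ℝ) + 2 * s))


lemma lintegral_norm_polar {E : Type*} [NormedAddCommGroup E] [NormedSpace ℝ E]
    [Nontrivial E] [MeasurableSpace E] [FiniteDimensional ℝ E] [BorelSpace E]
    (μ : Measure E) [μ.IsAddHaarMeasure] (f : ℝ → ℝ≥0∞) (hf : Measurable f) :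
    ∫⁻ x, f ‖x‖ ∂μ = Module.finrank ℝ E * μ (Metric.ball 0 1) *
      ∫⁻ y in Set.Ioi (0:ℝ), ENNReal.ofReal (y ^ (Module.finrank ℝ E - 1)) * f y := by
  calc
    ∫⁻ x, f ‖x‖ ∂μ = ∫⁻ x : ({(0)}ᶜ : Set E), f (‖x.1‖) ∂(μ.comap (↑)) := by
      rw [lintegral_subtype_comap (measurableSet_singleton _).compl fun x ↦ f (‖x‖),
        restrict_compl_singleton]
    _ = ∫⁻ x, f x.2 ∂μ.toSphere.prod (.volumeIoiPow (Module.finrank ℝ E - 1)) := by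
      simpa using μ.measurePreserving_homeomorphUnitSphereProd.lintegral_comp_emb
        (Homeomorph.measurableEmbedding _) (f ∘ Subtype.val ∘ Prod.snd)
    _ = μ.toSphere Set.univ *
        ∫⁻ x : Set.Ioi (0 : ℝ), f x ∂.volumeIoiPow (Module.finrank ℝ E - 1) := by
      rw [lintegral_prod _ (by fun_prop)]
      simp [mul_comm]
    _ = _ := by
      rw [μ.toSphere_apply_univ, Measure.volumeIoiPow,
        lintegral_withDensity_eq_lintegral_mul _ (by fun_prop) (by fun_prop)]
      simp only [Pi.mul_apply]
      rw [lintegral_subtype_comap measurableSet_Ioi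
        (fun a : ℝ ↦ ENNReal.ofReal (a ^ (Module.finrank ℝ E - 1)) * f a)]

lemma lintegral_slice (n : ℕ) (F : EuclideanSpace ℝ (Fin (n + 1)) → ℝ≥0∞) (hF : Measurable F) :
    ∫⁻ x, F x = ∫⁻ x' : EuclideanSpace ℝ (Fin n), ∫⁻ t : ℝ,
      F (WithLp.toLp 2 (Fin.cons t x'.ofLp : Fin (n + 1) → ℝ)) := by
  have hFt : Measurable (fun v : Fin (n+1) → ℝ => F (WithLp.toLp 2 v)) := by fun_prop
  have h1 : ∫⁻ x, F x = ∫⁻ v : Fin (n+1) → ℝ, F (WithLp.toLp 2 v) :=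
    ((PiLp.volume_preserving_toLp (Fin (n+1))).lintegral_comp hF).symm
  have h2 := ((volume_preserving_piFinSuccAbove (fun _ : Fin (n + 1) => ℝ) 0).symm _).lintegral_comp
    hFt
  have hm : Measurable (fun p : ℝ × (Fin n → ℝ) =>
      F (WithLp.toLp 2 (Fin.cons p.1 p.2 : Fin (n + 1) → ℝ))) := by
    have := hFt.comp ((volume_preserving_piFinSuccAbove (fun _ : Fin (n + 1) => ℝ) 0).symm _).measurable
    convert this using 1
    ext p
    simp [MeasurableEquiv.piFinSuccAbove, Fin.insertNthEquiv]
  have h3 : ∀ p : ℝ × (Fin n → ℝ), ((MeasurableEquiv.piFinSuccAbove (fun _ => ℝ) 0).symm p : Fin (n+1) → ℝ) = (Fin.cons p.1 p.2 : Fin (n + 1) → ℝ) := by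
    intro p
    simp [MeasurableEquiv.piFinSuccAbove, Fin.insertNthEquiv]
  simp only [h3] at h2
  rw [h1, ← h2, Measure.volume_eq_prod, lintegral_prod_symm' _ hm]
  symm
  exact (PiLp.volume_preserving_ofLp (Fin n)).lintegral_comp (f := fun y : Fin n → ℝ => ∫⁻ t : ℝ,
      F (WithLp.toLp 2 (Fin.cons t y : Fin (n + 1) → ℝ))) (by
      exact hm.lintegral_prod_left')

lemma vol_diff_one (a r : ℝ) (ha : 0 ≤ a) (hr : 0 ≤ r) :
    volume (Set.Ioo (-a) a \ Set.Ioo (-a - r) (a - r)) = ENNReal.ofReal (min r (2 * a)) := by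
  rcases le_or_gt (2 * a) r with h | h
  · have : Set.Ioo (-a) a \ Set.Ioo (-a - r) (a - r) = Set.Ioo (-a) a := by
      ext t; simp only [Set.mem_sdiff, Set.mem_Ioo]; constructor
      · exact fun h => h.1
      · intro h'; refine ⟨h', ?_⟩; rintro ⟨h1, h2⟩; linarith [h'.1]
    rw [this, Real.volume_Ioo, min_eq_right h]; ring_nf
  · rcases hr.eq_or_lt with rfl | hr
    · simp
    have : Set.Ioo (-a) a \ Set.Ioo (-a - r) (a - r) = Set.Ico (a - r) a := by
      ext t; simp only [Set.mem_sdiff, Set.mem_Ioo, Set.mem_Ico, not_and, not_lt]; constructor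
      · intro h'; exact ⟨h'.2 (by linarith [h'.1.1]), h'.1.2⟩
      · intro h'; exact ⟨⟨by linarith [h'.1], h'.2⟩, fun _ => h'.1⟩
    rw [this, Real.volume_Ico, min_eq_left h.le]; ring_nf

lemma vol_diff_two (a r : ℝ) (ha : 0 ≤ a) (hr : 0 ≤ r) :
    volume (Set.Ioo (-a - r) (a - r) \ Set.Ioo (-a) a) = ENNReal.ofReal (min r (2 * a)) := by
  rw [← vol_diff_one a r ha hr, ← Measure.measure_neg,
    ← measure_preimage_add_right volume r]
  congr 1
  ext t
  simp only [Set.mem_preimage, Set.mem_neg, Set.mem_sdiff, Set.mem_Ioo]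
  constructor
  · rintro ⟨⟨h1, h2⟩, h3⟩
    exact ⟨⟨by linarith, by linarith⟩, fun h4 => h3 ⟨by linarith [h4.2], by linarith [h4.1]⟩⟩
  · rintro ⟨⟨h1, h2⟩, h3⟩
    exact ⟨⟨by linarith, by linarith⟩, fun h4 => h3 ⟨by linarith [h4.2], by linarith [h4.1]⟩⟩

lemma lintegral_one_dim (a r : ℝ) (ha : 0 ≤ a) (hr : 0 ≤ r) :
    ∫⁻ t : ℝ, ENNReal.ofReal (|(Set.Ioo (-a) a).indicator (fun _ => (1:ℝ)) t
      - (Set.Ioo (-a) a).indicator (fun _ => (1:ℝ)) (t + r)| ^ 2)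
      = 2 * ENNReal.ofReal (min r (2 * a)) := by
  set A := Set.Ioo (-a) a
  set A' := Set.Ioo (-a - r) (a - r)
  have h : ∀ t : ℝ, ENNReal.ofReal (|A.indicator (fun _ => (1:ℝ)) t
      - A.indicator (fun _ => (1:ℝ)) (t + r)| ^ 2)
      = (A \ A').indicator (fun _ => (1 : ℝ≥0∞)) t + (A' \ A).indicator (fun _ => (1 : ℝ≥0∞)) t := by
    intro t
    have e : t + r ∈ A ↔ t ∈ A' := by
      simp only [A, A', Set.mem_Ioo]
      constructor <;> rintro ⟨h1, h2⟩ <;> constructor <;> linarith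
    by_cases h1 : t ∈ A <;> by_cases h2 : t ∈ A' <;>
      simp [Set.indicator, h1, h2, e]
  simp_rw [h]
  have mA : MeasurableSet A := measurableSet_Ioo
  have mA' : MeasurableSet A' := measurableSet_Ioo
  rw [lintegral_add_left (by exact measurable_const.indicator (mA.diff mA')),
    lintegral_indicator_const (mA.diff mA'), lintegral_indicator_const (mA'.diff mA),
    vol_diff_one a r ha hr, vol_diff_two a r ha hr]
  ring

lemma lintegral_radial_min (s b : ℝ) (hs : 0 < s) (hs' : s < 1/2) (hb : 0 ≤ b) :
    ∫⁻ r in Set.Ioi (0:ℝ), ENNReal.ofReal (r ^ (-1 - 2 * s)) * ENNReal.ofReal (min r b)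
      = ENNReal.ofReal (b ^ (1 - 2 * s) / (2 * s * (1 - 2 * s))) := by
  rcases hb.eq_or_lt with rfl | hb
  · rw [Real.zero_rpow (by linarith)]
    simp only [zero_div, ENNReal.ofReal_zero]
    rw [setLIntegral_congr_fun (g := fun _ => 0) measurableSet_Ioi]
    · simp
    · intro r hr
      have : min r 0 = 0 := min_eq_right (le_of_lt hr)
      simp [this]
  rw [← Set.Ioc_union_Ioi_eq_Ioi hb.le, lintegral_union measurableSet_Ioi
    (Set.Ioc_disjoint_Ioi le_rfl)]
  have h1 : ∫⁻ r in Set.Ioc 0 b, ENNReal.ofReal (r ^ (-1 - 2 * s)) * ENNReal.ofReal (min r b)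
      = ENNReal.ofReal (b ^ (1 - 2 * s) / (1 - 2 * s)) := by
    have e : ∫⁻ r in Set.Ioc 0 b, ENNReal.ofReal (r ^ (-1 - 2 * s)) * ENNReal.ofReal (min r b)
      = ∫⁻ r in Set.Ioc 0 b, ENNReal.ofReal (r ^ (- (2 * s))) := by
      refine setLIntegral_congr_fun measurableSet_Ioc fun r hr => ?_
      have hr0 : 0 < r := hr.1
      rw [min_eq_left hr.2, ← ENNReal.ofReal_mul (by positivity), ← Real.rpow_add_one hr0.ne']
      ring_nf
    rw [e, ← ofReal_integral_eq_lintegral_ofReal, ← intervalIntegral.integral_of_le hb.le,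
      integral_rpow (Or.inl (by linarith)), Real.zero_rpow (by linarith)]
    · ring_nf
    · exact (intervalIntegral.intervalIntegrable_rpow' (by linarith)).1
    · filter_upwards [ae_restrict_mem measurableSet_Ioc] with y hy
      exact Real.rpow_nonneg hy.1.le _
  have h2 : ∫⁻ r in Set.Ioi b, ENNReal.ofReal (r ^ (-1 - 2 * s)) * ENNReal.ofReal (min r b)
      = ENNReal.ofReal (b ^ (1 - 2 * s) / (2 * s)) := by
    have e : ∫⁻ r in Set.Ioi b, ENNReal.ofReal (r ^ (-1 - 2 * s)) * ENNReal.ofReal (min r b)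
      = ∫⁻ r in Set.Ioi b, ENNReal.ofReal (r ^ (-1 - 2 * s)) * ENNReal.ofReal b := by
      refine setLIntegral_congr_fun measurableSet_Ioi fun r hr => ?_
      rw [min_eq_right (le_of_lt hr)]
    rw [e, lintegral_mul_const _ (by fun_prop), ← ofReal_integral_eq_lintegral_ofReal,
      integral_Ioi_rpow_of_lt (by linarith) hb, ← ENNReal.ofReal_mul']
    · congr 1
      rw [show 1 - 2 * s = (-1 - 2 * s + 1) + 1 by ring, Real.rpow_add_one hb.ne' (-1 - 2 * s + 1)]
      rw [show -1 - 2 * s + 1 = -(2 * s) by ring]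
      field_simp
    · exact hb.le
    · exact integrableOn_Ioi_rpow_of_lt (by linarith) hb
    · filter_upwards [ae_restrict_mem measurableSet_Ioi] with y hy
      exact Real.rpow_nonneg (hb.le.trans (le_of_lt hy)) _
  have hp : 0 < 1 - 2 * s := by linarith
  rw [h1, h2, ← ENNReal.ofReal_add (by positivity) (by positivity)]
  congr 1
  field_simp
  ring

lemma lintegral_beta_Ioo (α β : ℝ) (hα : 0 < α) (hβ : 0 < β) :
    ∫⁻ x in Set.Ioo (0:ℝ) 1, ENNReal.ofReal (x ^ (α - 1) * (1 - x) ^ (β - 1))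
      = ENNReal.ofReal (ProbabilityTheory.beta α β) := by
  have h := ProbabilityTheory.lintegral_betaPDF_eq_one hα hβ
  have hb := ProbabilityTheory.beta_pos hα hβ
  rw [ProbabilityTheory.lintegral_betaPDF] at h
  have : ∀ x : ℝ, ENNReal.ofReal (1 / ProbabilityTheory.beta α β * x ^ (α - 1) * (1 - x) ^ (β - 1))
    = ENNReal.ofReal (1 / ProbabilityTheory.beta α β) *
      ENNReal.ofReal (x ^ (α - 1) * (1 - x) ^ (β - 1)) := by
    intro x; rw [← ENNReal.ofReal_mul (by positivity), mul_assoc]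
  simp_rw [this] at h
  rw [lintegral_const_mul _ (by fun_prop)] at h
  have h2 : ENNReal.ofReal (ProbabilityTheory.beta α β) *
    ENNReal.ofReal (1 / ProbabilityTheory.beta α β) = 1 := by
    rw [← ENNReal.ofReal_mul hb.le, mul_one_div_cancel hb.ne', ENNReal.ofReal_one]
  rw [← mul_one (ENNReal.ofReal (ProbabilityTheory.beta α β)), ← h, ← mul_assoc, h2, one_mul]

/-- Radial beta integral -/
lemma lintegral_radial_beta (n : ℕ) (β : ℝ) (hβ : 0 < β) :
    ∫⁻ y in Set.Ioo (0:ℝ) 1, ENNReal.ofReal (y ^ n * (1 - y ^ 2) ^ (β - 1))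
      = ENNReal.ofReal (ProbabilityTheory.beta (((n:ℝ) + 1) / 2) β / 2) := by
  have himg : (fun y : ℝ => y ^ 2) '' Set.Ioo (0:ℝ) 1 = Set.Ioo 0 1 := by
    ext x; constructor
    · rintro ⟨y, ⟨h0, h1⟩, rfl⟩
      exact ⟨by positivity, by simp only; nlinarith⟩
    · rintro ⟨h0, h1⟩
      refine ⟨√x, ⟨Real.sqrt_pos.2 h0, ?_⟩, Real.sq_sqrt h0.le⟩
      rw [Real.sqrt_lt' one_pos]; simpa using h1
  have h := lintegral_image_eq_lintegral_abs_deriv_mul (s := Set.Ioo (0:ℝ) 1)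
    (f := fun y => y ^ 2) (f' := fun y => 2 * y) measurableSet_Ioo
    (fun x _ => by simpa using ((hasDerivAt_pow 2 x).hasDerivWithinAt))
    (fun x hx y hy hxy => by
      simp only at hxy
      exact (pow_left_inj₀ hx.1.le hy.1.le two_ne_zero).1 hxy)
    (fun x => ENNReal.ofReal (x ^ ((((n:ℝ) + 1) / 2) - 1) * (1 - x) ^ (β - 1)))
  rw [himg, lintegral_beta_Ioo _ _ (by positivity) hβ] at h
  rw [ENNReal.ofReal_div_of_pos two_pos, h, eq_comm, ENNReal.div_eq_inv_mul,
    ← lintegral_const_mul' _ _ (by simp)]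
  refine setLIntegral_congr_fun measurableSet_Ioo fun y hy => ?_
  have hy0 : 0 < y := hy.1
  have hy1 : 0 ≤ 1 - y ^ 2 := by nlinarith [hy.2]
  rw [← ENNReal.ofReal_inv_of_pos two_pos, ← ENNReal.ofReal_mul (by positivity),
    ← ENNReal.ofReal_mul (by positivity)]
  congr 1
  rw [abs_of_pos (by positivity), ← Real.rpow_natCast y 2, ← Real.rpow_mul hy0.le,
    ← Real.rpow_natCast y n]
  have : y ^ (n:ℝ) = y * y ^ (((2:ℕ):ℝ) * (((n:ℝ) + 1) / 2 - 1)) := by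
    rw [mul_comm y, ← Real.rpow_add_one hy0.ne']; congr 1; push_cast; ring
  rw [this]; ring

lemma lintegral_sqrt_ball (n : ℕ) (s : ℝ) (hs' : s < 1/2) :
    ∫⁻ x : EuclideanSpace ℝ (Fin (n+1)), ENNReal.ofReal ((2 * √(1 - ‖x‖ ^ 2)) ^ (1 - 2 * s))
     = (((n + 1 : ℕ) : ℝ≥0∞)) * volume (Metric.ball (0 : EuclideanSpace ℝ (Fin (n+1))) 1) *
      ENNReal.ofReal (2 ^ (1 - 2 * s) *
        (ProbabilityTheory.beta (((n:ℝ) + 1) / 2) (3 / 2 - s) / 2)) := by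
  rw [lintegral_norm_polar volume (fun y => ENNReal.ofReal ((2 * √(1 - y ^ 2)) ^ (1 - 2 * s)))
    (by fun_prop)]
  rw [finrank_euclideanSpace_fin, ENNReal.ofReal_mul (by positivity), ← lintegral_radial_beta n _ (by linarith)]
  congr 1
  rw [← lintegral_const_mul' _ _ (by simp)]
  rw [← Set.Ioo_union_Ici_eq_Ioi (zero_lt_one' ℝ), lintegral_union measurableSet_Ici
    (by rw [Set.disjoint_left]; intro x hx hx'; exact absurd hx.2 (not_lt.2 hx'))]
  have z : ∫⁻ y in Set.Ici (1:ℝ), ENNReal.ofReal (y ^ (n + 1 - 1)) *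
      ENNReal.ofReal ((2 * √(1 - y ^ 2)) ^ (1 - 2 * s)) = 0 := by
    rw [setLIntegral_congr_fun (g := fun _ => 0) measurableSet_Ici]
    · simp
    · intro y hy
      have hy' : (1:ℝ) ≤ y := hy
      simp only
      rw [Real.sqrt_eq_zero'.2 (by nlinarith), mul_zero, Real.zero_rpow (by linarith)]
      simp
  rw [z, add_zero]
  refine setLIntegral_congr_fun measurableSet_Ioo fun y hy => ?_
  have hy0 : 0 < y := hy.1
  have hy1 : 0 ≤ 1 - y ^ 2 := by nlinarith [hy.2]
  rw [← ENNReal.ofReal_mul (by positivity), ← ENNReal.ofReal_mul (by positivity)]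
  congr 1
  rw [Real.mul_rpow (by norm_num) (Real.sqrt_nonneg _), Real.sqrt_eq_rpow, ← Real.rpow_mul hy1,
    Nat.add_sub_cancel, show 1 / 2 * (1 - 2 * s) = 3 / 2 - s - 1 by ring]
  ring

lemma cons_mem_ball (n : ℕ) (t : ℝ) (x' : EuclideanSpace ℝ (Fin n)) :
    (WithLp.toLp 2 (Fin.cons t x'.ofLp : Fin (n + 1) → ℝ)) ∈
      Metric.ball (0 : EuclideanSpace ℝ (Fin (n+1))) 1 ↔
    t ∈ Set.Ioo (-√(1 - ‖x'‖ ^ 2)) (√(1 - ‖x'‖ ^ 2)) := by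
  rw [mem_ball_zero_iff, ← abs_lt.trans Set.mem_Ioo.symm, Real.lt_sqrt (abs_nonneg t), sq_abs,
    ← sq_lt_one_iff₀ (norm_nonneg _), EuclideanSpace.real_norm_sq_eq, EuclideanSpace.real_norm_sq_eq,
    Fin.sum_univ_succ]
  simp only [Fin.cons_zero, Fin.cons_succ]
  constructor <;> intro h <;> linarith

/-- Indicator of the unit ball -/
noncomputable def ballInd (N : ℕ) (x : EuclideanSpace ℝ (Fin N)) : ℝ :=
  (Metric.ball (0 : EuclideanSpace ℝ (Fin N)) 1).indicator (fun _ => (1 : ℝ)) x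

@[fun_prop]
lemma measurable_ballInd (N : ℕ) : Measurable (ballInd N) :=
  measurable_const.indicator measurableSet_ball

lemma ballInd_congr {N M : ℕ} {x : EuclideanSpace ℝ (Fin N)} {y : EuclideanSpace ℝ (Fin M)}
    (h : ‖x‖ = ‖y‖) : ballInd N x = ballInd M y := by
  simp [ballInd, Set.indicator, h]

lemma ballInd_cons (n : ℕ) (t : ℝ) (x' : EuclideanSpace ℝ (Fin n)) :
    ballInd (n+1) (WithLp.toLp 2 (Fin.cons t x'.ofLp : Fin (n + 1) → ℝ)) =
    (Set.Ioo (-√(1 - ‖x'‖ ^ 2)) (√(1 - ‖x'‖ ^ 2))).indicator (fun _ => (1:ℝ)) t := by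
  simp only [ballInd, Set.indicator, cons_mem_ball]

lemma lintegral_shift_axis (n : ℕ) (r : ℝ) (hr : 0 ≤ r) :
    ∫⁻ x, ENNReal.ofReal (|ballInd (n+1) x - ballInd (n+1)
      (x + WithLp.toLp 2 (Fin.cons r 0 : Fin (n + 1) → ℝ))| ^ 2) =
    ∫⁻ x' : EuclideanSpace ℝ (Fin n), 2 * ENNReal.ofReal (min r (2 * √(1 - ‖x'‖ ^ 2))) := by
  rw [lintegral_slice _ _ (by fun_prop)]
  refine lintegral_congr fun x' => ?_
  rw [← lintegral_one_dim _ _ (Real.sqrt_nonneg _) hr]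
  refine lintegral_congr fun t => ?_
  have : (WithLp.toLp 2 (Fin.cons t x'.ofLp : Fin (n + 1) → ℝ) +
      WithLp.toLp 2 (Fin.cons r 0 : Fin (n + 1) → ℝ)) =
      WithLp.toLp 2 (Fin.cons (t + r) x'.ofLp : Fin (n + 1) → ℝ) := by
    ext i
    refine Fin.cases ?_ (fun j => ?_) i <;> simp
  rw [this, ballInd_cons, ballInd_cons]

lemma lintegral_shift (n : ℕ) (h : EuclideanSpace ℝ (Fin (n+1))) :
    ∫⁻ x, ENNReal.ofReal (|ballInd (n+1) x - ballInd (n+1) (x + h)| ^ 2) =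
    ∫⁻ x' : EuclideanSpace ℝ (Fin n), 2 * ENNReal.ofReal (min ‖h‖ (2 * √(1 - ‖x'‖ ^ 2))) := by
  rw [← lintegral_shift_axis n _ (norm_nonneg h)]
  set e : EuclideanSpace ℝ (Fin (n+1)) := WithLp.toLp 2 (Fin.cons ‖h‖ 0 : Fin (n + 1) → ℝ)
  have he : ‖h‖ = ‖e‖ := by
    rw [← sq_eq_sq₀ (norm_nonneg _) (norm_nonneg _), EuclideanSpace.real_norm_sq_eq e,
      Fin.sum_univ_succ]
    simp [e]
  set R := (ℝ ∙ (h - e))ᗮ.reflection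
  have hR : R h = e := Submodule.reflection_sub he
  symm
  rw [← R.measurePreserving.lintegral_comp (by fun_prop)]
  refine lintegral_congr fun x => ?_
  rw [← hR, ← map_add, ballInd_congr (R.norm_map x), ballInd_congr (R.norm_map (x + h))]

lemma fracPerimeter_eq_polar (n : ℕ) (s : ℝ) (hs : 0 < s) (hs' : s < 1 / 2) :
    fracPerimeter (n+2) s (Metric.ball 0 1) =
      ((n + 2 : ℕ) : ℝ≥0∞) * volume (Metric.ball (0 : EuclideanSpace ℝ (Fin (n+2))) 1) *
      (2 * (ENNReal.ofReal (1 / (2 * s * (1 - 2 * s))) *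
      ∫⁻ x : EuclideanSpace ℝ (Fin (n+1)),
        ENNReal.ofReal ((2 * √(1 - ‖x‖ ^ 2)) ^ (1 - 2 * s)))) := by
  have hp : 0 < 1 - 2 * s := by linarith
  calc
    fracPerimeter (n+2) s (Metric.ball 0 1)
      = ∫⁻ x, ∫⁻ y, ENNReal.ofReal (|ballInd (n+2) x - ballInd (n+2) y| ^ 2
      / ‖x - y‖ ^ (((n + 2 : ℕ) : ℝ) + 2 * s)) := rfl
    _ = ∫⁻ x, ∫⁻ h, ENNReal.ofReal (|ballInd (n+2) x - ballInd (n+2) (x + h)| ^ 2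
      / ‖h‖ ^ (((n + 2 : ℕ) : ℝ) + 2 * s)) := by
        refine lintegral_congr fun x => ?_
        rw [← lintegral_add_left_eq_self _ x]
        simp
    _ = ∫⁻ h, ∫⁻ x, ENNReal.ofReal (|ballInd (n+2) x - ballInd (n+2) (x + h)| ^ 2
      / ‖h‖ ^ (((n + 2 : ℕ) : ℝ) + 2 * s)) := by
        rw [lintegral_lintegral_swap]
        apply Measurable.aemeasurable
        unfold Function.uncurry
        fun_prop
    _ = ∫⁻ h : EuclideanSpace ℝ (Fin (n+2)),
        ENNReal.ofReal ((‖h‖ ^ (((n + 2 : ℕ) : ℝ) + 2 * s))⁻¹) *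
        ∫⁻ x' : EuclideanSpace ℝ (Fin (n+1)),
          2 * ENNReal.ofReal (min ‖h‖ (2 * √(1 - ‖x'‖ ^ 2))) := by
        refine lintegral_congr fun h => ?_
        rw [← lintegral_shift, ← lintegral_const_mul' _ _ (by simp)]
        refine lintegral_congr fun x => ?_
        rw [← ENNReal.ofReal_mul (by positivity), div_eq_inv_mul]
    _ = ((n + 2 : ℕ) : ℝ≥0∞) * volume (Metric.ball (0 : EuclideanSpace ℝ (Fin (n+2))) 1) *
      ∫⁻ r in Set.Ioi (0:ℝ), ENNReal.ofReal (r ^ (n + 1)) *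
        (ENNReal.ofReal ((r ^ (((n + 2 : ℕ) : ℝ) + 2 * s))⁻¹) *
        ∫⁻ x' : EuclideanSpace ℝ (Fin (n+1)),
          2 * ENNReal.ofReal (min r (2 * √(1 - ‖x'‖ ^ 2)))) := by
        rw [lintegral_norm_polar volume (fun r => ENNReal.ofReal ((r ^ (((n + 2 : ℕ) : ℝ) + 2 * s))⁻¹) *
        ∫⁻ x' : EuclideanSpace ℝ (Fin (n+1)),
          2 * ENNReal.ofReal (min r (2 * √(1 - ‖x'‖ ^ 2))))]
        · rw [finrank_euclideanSpace_fin]; rfl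
        · refine Measurable.mul (by fun_prop) ?_
          apply Measurable.lintegral_prod_right'
            (f := fun p : ℝ × EuclideanSpace ℝ (Fin (n+1)) =>
              2 * ENNReal.ofReal (min p.1 (2 * √(1 - ‖p.2‖ ^ 2))))
          fun_prop
    _ = _ := by
        congr 1
        calc
          _ = ∫⁻ r in Set.Ioi (0:ℝ), ∫⁻ x' : EuclideanSpace ℝ (Fin (n+1)),
            2 * (ENNReal.ofReal (r ^ (-1 - 2 * s)) *
              ENNReal.ofReal (min r (2 * √(1 - ‖x'‖ ^ 2)))) := by
            refine setLIntegral_congr_fun measurableSet_Ioi fun r hr => ?_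
            have hr0 : 0 < r := hr
            rw [← mul_assoc, ← ENNReal.ofReal_mul (by positivity),
              ← lintegral_const_mul' _ _ (by simp)]
            refine lintegral_congr fun x => ?_
            rw [mul_left_comm, ← Real.rpow_neg hr0.le, ← Real.rpow_natCast, ← Real.rpow_add hr0]
            congr 4
            push_cast; ring
          _ = ∫⁻ x' : EuclideanSpace ℝ (Fin (n+1)), ∫⁻ r in Set.Ioi (0:ℝ),
            2 * (ENNReal.ofReal (r ^ (-1 - 2 * s)) *
              ENNReal.ofReal (min r (2 * √(1 - ‖x'‖ ^ 2)))) := by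
            rw [lintegral_lintegral_swap]
            apply Measurable.aemeasurable
            unfold Function.uncurry
            fun_prop
          _ = _ := by
            rw [← lintegral_const_mul' _ _ (by simp), ← lintegral_const_mul' _ _ (by simp)]
            refine lintegral_congr fun x => ?_
            rw [lintegral_const_mul' _ _ (by simp), lintegral_radial_min s _ hs hs' (by positivity),
              ← ENNReal.ofReal_mul (by positivity)]
            congr 2
            ring

lemma vol_ball_fin (n : ℕ) : volume (Metric.ball (0 : EuclideanSpace ℝ (Fin (n+1))) 1) =
    ENNReal.ofReal (π ^ (((n:ℝ) + 1) / 2) / Gamma (((n:ℝ) + 1) / 2 + 1)) := by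
  rw [EuclideanSpace.volume_ball]
  simp only [ENNReal.ofReal_one, one_pow, one_mul, Fintype.card_fin]
  rw [Real.sqrt_eq_rpow, ← Real.rpow_natCast, ← Real.rpow_mul pi_pos.le]
  push_cast
  congr 3
  ring

lemma gamma_identity (n : ℕ) (s : ℝ) (hs : 0 < s) (hs' : s < 1 / 2) :
    2 * (1 / (2 * s * (1 - 2 * s)) * ((((n + 1 : ℕ) : ℝ) *
      (π ^ (((n:ℝ) + 1) / 2) / Gamma (((n:ℝ) + 1) / 2 + 1))) *
      (2 ^ (1 - 2 * s) *
        (ProbabilityTheory.beta (((n:ℝ) + 1) / 2) (3 / 2 - s) / 2)))) =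
    π ^ (((n:ℝ) + 2) / 2) * Gamma (1 - 2 * s) /
      (s * Gamma (1 - s) * Gamma (((n:ℝ) + 2 + 2 - 2 * s) / 2)) := by
  have hp : 0 < 1 - 2 * s := by linarith
  have g1 : 0 < Gamma (((n:ℝ) + 1) / 2) := Gamma_pos_of_pos (by positivity)
  have g2 : 0 < Gamma (((n:ℝ) + 2 + 2 - 2 * s) / 2) :=
    Gamma_pos_of_pos (by have : (0:ℝ) ≤ n := Nat.cast_nonneg n; linarith)
  have g3 : 0 < Gamma (1 - s) := Gamma_pos_of_pos (by linarith)
  have e1 : Gamma (3 / 2 - s) = (1 / 2 - s) * Gamma (1 / 2 - s) := by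
    rw [← Gamma_add_one (by linarith)]; ring_nf
  have e2 : Gamma (1 / 2 - s) * Gamma (1 - s) = Gamma (1 - 2 * s) * 2 ^ (2 * s) * √π := by
    have := Real.Gamma_mul_Gamma_add_half (1 / 2 - s)
    convert this using 3 <;> ring_nf
  have e3 : π ^ (((n:ℝ) + 2) / 2) = π ^ (((n:ℝ) + 1) / 2) * √π := by
    rw [Real.sqrt_eq_rpow, ← Real.rpow_add pi_pos]; ring_nf
  have e4 : (2:ℝ) ^ (1 - 2 * s) = 2 / 2 ^ (2 * s) := by
    rw [Real.rpow_sub two_pos, Real.rpow_one]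
  have e5 : Gamma (1 / 2 - s) = Gamma (1 - 2 * s) * 2 ^ (2 * s) * √π / Gamma (1 - s) := by
    rw [← e2]; field_simp
  rw [Gamma_add_one (by positivity), ProbabilityTheory.beta, e1,
    show ((n:ℝ) + 1) / 2 + (3 / 2 - s) = ((n:ℝ) + 2 + 2 - 2 * s) / 2 by ring, e3, e4, e5]
  have h2 : (0:ℝ) < 2 ^ (2 * s) := by positivity
  push_cast
  field_simp

theorem fracPerimeter_isoperimetric_quotient_ball (N : ℕ) (hN : 2 ≤ N)
    (s : ℝ) (hs : 0 < s) (hs' : s < 1 / 2) :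
    fracPerimeter N s (Metric.ball (0 : EuclideanSpace ℝ (Fin N)) 1)
      / (volume (Metric.ball (0 : EuclideanSpace ℝ (Fin N)) 1)) ^ (((N : ℝ) - 2 * s) / N)
    = ENNReal.ofReal
        (N * π ^ ((N : ℝ) / 2 + s) * Gamma (1 - 2 * s)
          / (s * Gamma ((N : ℝ) / 2 + 1) ^ (2 * s / (N : ℝ)) * Gamma (1 - s)
              * Gamma (((N : ℝ) + 2 - 2 * s) / 2))) := by
  obtain ⟨n, rfl⟩ : ∃ n, N = n + 2 := ⟨N - 2, by omega⟩
  have hp : 0 < 1 - 2 * s := by linarith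
  have hn : (0:ℝ) ≤ n := Nat.cast_nonneg n
  have g0 : 0 < Gamma (((n:ℝ) + 2) / 2 + 1) := Gamma_pos_of_pos (by positivity)
  have g1 : 0 < Gamma (((n:ℝ) + 1) / 2 + 1) := Gamma_pos_of_pos (by positivity)
  have g2 : 0 < Gamma (((n:ℝ) + 2 + 2 - 2 * s) / 2) := Gamma_pos_of_pos (by linarith)
  have g3 : 0 < Gamma (1 - s) := Gamma_pos_of_pos (by linarith)
  have hb := ProbabilityTheory.beta_pos (α := ((n:ℝ) + 1) / 2) (β := 3 / 2 - s) (by positivity)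
    (by linarith)
  have hv : volume (Metric.ball (0 : EuclideanSpace ℝ (Fin (n+2))) 1) =
      ENNReal.ofReal (π ^ (((n:ℝ) + 2) / 2) / Gamma (((n:ℝ) + 2) / 2 + 1)) := by
    rw [vol_ball_fin (n+1)]; push_cast; ring_nf
  rw [fracPerimeter_eq_polar n s hs hs', lintegral_sqrt_ball n s hs', vol_ball_fin n, hv]
  set W := π ^ (((n:ℝ) + 2) / 2) / Gamma (((n:ℝ) + 2) / 2 + 1) with hW
  have hWp : 0 < W := by positivity
  rw [← ENNReal.ofReal_natCast (n+2), ← ENNReal.ofReal_natCast (n+1), ← ENNReal.ofReal_ofNat 2,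
    ENNReal.ofReal_rpow_of_pos hWp,
    ← ENNReal.ofReal_mul (by positivity), ← ENNReal.ofReal_mul (by positivity),
    ← ENNReal.ofReal_mul (by positivity), ← ENNReal.ofReal_mul (by positivity),
    ← ENNReal.ofReal_mul (by positivity), ← ENNReal.ofReal_mul (by positivity),
    ← ENNReal.ofReal_div_of_pos (by positivity), gamma_identity n s hs hs']
  congr 1
  push_cast
  have hN : (n:ℝ) + 2 ≠ 0 := by positivity
  have e1 : W ^ (((n:ℝ) + 2 - 2 * s) / ((n:ℝ) + 2)) = W / W ^ (2 * s / ((n:ℝ) + 2)) := by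
    rw [sub_div, div_self hN, Real.rpow_sub hWp, Real.rpow_one]
  have e2 : W ^ (2 * s / ((n:ℝ) + 2)) =
      π ^ s / Gamma (((n:ℝ) + 2) / 2 + 1) ^ (2 * s / ((n:ℝ) + 2)) := by
    rw [hW, Real.div_rpow (by positivity) g0.le, ← Real.rpow_mul pi_pos.le]
    congr 2
    field_simp
  rw [e1, e2, Real.rpow_add pi_pos]
  have h5 : 0 < Gamma (((n:ℝ) + 2) / 2 + 1) ^ (2 * s / ((n:ℝ) + 2)) := by positivity
  have h6 : 0 < π ^ s := by positivity
  field_simp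
end

section
/- Let N ≥ 2 and 0 < s < 1/2. Then the fractional s-perimeter of the unit ball B_1 ⊂ ℝ^N is given explicitly by P_s(B_1) = N · π^N · Γ(1-2s) / ( s · Γ(N/2 + 1) · Γ(1-s) · Γ((N+2-2s)/2) ). -/
open MeasureTheory Real
open scoped ENNReal

open Measure in
lemma aux_radial (n : ℕ) (hn : 1 ≤ n) (f : ℝ → ℝ≥0∞) (hf : Measurable f) :
    ∫⁻ x : EuclideanSpace ℝ (Fin n), f ‖x‖ =
      n * volume (Metric.ball (0 : EuclideanSpace ℝ (Fin n)) 1) *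
        ∫⁻ r in Set.Ioi (0:ℝ), ENNReal.ofReal (r ^ (n - 1)) * f r := by
  have : Nonempty (Fin n) := ⟨⟨0, hn⟩⟩
  let E := EuclideanSpace ℝ (Fin n)
  have h1 : ∫⁻ x : E, f ‖x‖ = ∫⁻ x : ({(0 : E)}ᶜ : Set E), f ‖x.1‖ ∂((volume : Measure E).comap Subtype.val) := by
    rw [lintegral_subtype_comap (measurableSet_singleton _).compl (fun x : E ↦ f ‖x‖),
      restrict_compl_singleton]
  have h2 : ∫⁻ x : ({(0 : E)}ᶜ : Set E), f ‖x.1‖ ∂((volume : Measure E).comap Subtype.val)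
      = ∫⁻ p, f p.2 ∂(volume : Measure E).toSphere.prod (volumeIoiPow (Module.finrank ℝ E - 1)) := by
    rw [← (volume : Measure E).measurePreserving_homeomorphUnitSphereProd.lintegral_comp
      (f := fun p => f p.2.1) (hf.comp (measurable_subtype_coe.comp measurable_snd))]
    simp
  have hm : Measurable fun p : Metric.sphere (0:E) 1 × Set.Ioi (0:ℝ) => f p.2.1 :=
    hf.comp (measurable_subtype_coe.comp measurable_snd)
  rw [h1, h2, lintegral_prod_symm' _ hm]
  simp only [lintegral_const]
  rw [lintegral_mul_const _ (show Measurable fun y : Set.Ioi (0:ℝ) => f y from hf.comp measurable_subtype_coe), toSphere_apply_univ, mul_comm]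
  have hd : Module.finrank ℝ E = n := by simp [E]
  rw [hd]
  congr 1
  rw [volumeIoiPow, lintegral_withDensity_eq_lintegral_mul _ (by fun_prop)
    (show Measurable fun y : Set.Ioi (0:ℝ) => f y from hf.comp measurable_subtype_coe)]
  exact lintegral_subtype_comap measurableSet_Ioi (fun r : ℝ ↦ ENNReal.ofReal (r ^ (n-1)) * f r)

lemma aux_slice (n : ℕ) (f : EuclideanSpace ℝ (Fin (n+1)) → ℝ≥0∞) (hf : Measurable f) :
    ∫⁻ x, f x = ∫⁻ z : EuclideanSpace ℝ (Fin n), ∫⁻ t : ℝ,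
      f (WithLp.toLp 2 (Fin.cons t z.ofLp)) := by
  rw [← (PiLp.volume_preserving_toLp (Fin (n+1))).lintegral_comp hf]
  have h1 := (volume_preserving_piFinSuccAbove (fun _ : Fin (n+1) => ℝ) 0).symm
  rw [← h1.lintegral_comp (f := fun a => f (WithLp.toLp 2 a)) (hf.comp (by fun_prop))]
  have hm : Measurable fun p : ℝ × (Fin n → ℝ) => f (WithLp.toLp 2 ((MeasurableEquiv.piFinSuccAbove (fun _ : Fin (n+1) => ℝ) 0).symm p)) :=
    hf.comp (by fun_prop)
  rw [Measure.volume_eq_prod]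
  rw [lintegral_prod_symm' _ hm]
  have hm2 : Measurable fun z : Fin n → ℝ => ∫⁻ t : ℝ, f (WithLp.toLp 2 ((MeasurableEquiv.piFinSuccAbove (fun _ : Fin (n+1) => ℝ) 0).symm (t, z))) :=
    hm.lintegral_prod_left'
  have h3 := (PiLp.volume_preserving_ofLp (Fin n)).lintegral_comp hm2
  rw [← h3]
  simp [MeasurableEquiv.piFinSuccAbove, Fin.insertNthEquiv]

lemma aux_interval (a r : ℝ) (hr : 0 ≤ r) :
    ∫⁻ t : ℝ, ENNReal.ofReal (|{t : ℝ | t^2 < a}.indicator (fun _ => (1:ℝ)) t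
      - {t : ℝ | t^2 < a}.indicator (fun _ => (1:ℝ)) (t + r)| ^ 2)
      = ENNReal.ofReal (2 * min r (2 * √a)) := by
  have hset : {t : ℝ | t^2 < a} = Set.Ioo (-√a) (√a) := by
    ext t; simp [Real.sq_lt]
  rw [hset]
  set l := √a
  have hl : 0 ≤ l := Real.sqrt_nonneg a
  rcases le_or_gt (2 * l) r with h | h
  · have : ∀ t : ℝ, ENNReal.ofReal (|(Set.Ioo (-l) l).indicator (fun _ => (1:ℝ)) t
      - (Set.Ioo (-l) l).indicator (fun _ => (1:ℝ)) (t + r)| ^ 2) =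
      (Set.Ioo (-l) l).indicator (fun _ => (1:ℝ≥0∞)) t
        + (Set.Ioo (-l-r) (l-r)).indicator (fun _ => (1:ℝ≥0∞)) t := by
      intro t
      by_cases h1 : -l < t <;> by_cases h2 : t < l <;> by_cases h3 : -l < t + r <;>
        by_cases h4 : t + r < l <;>
        simp [Set.indicator, h1, h2, h3, h4, sub_lt_iff_lt_add, lt_sub_iff_add_lt] <;> linarith
    simp_rw [this]
    rw [lintegral_add_left (by fun_prop (disch := measurability)),
      lintegral_indicator measurableSet_Ioo, lintegral_indicator measurableSet_Ioo,
      min_eq_right h]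
    simp only [lintegral_const, Measure.restrict_apply_univ, Real.volume_Ioo, one_mul]
    rw [← ENNReal.ofReal_add (by linarith) (by linarith)]
    ring_nf
  · have : ∀ t : ℝ, ENNReal.ofReal (|(Set.Ioo (-l) l).indicator (fun _ => (1:ℝ)) t
      - (Set.Ioo (-l) l).indicator (fun _ => (1:ℝ)) (t + r)| ^ 2) =
      (Set.Ico (l-r) l).indicator (fun _ => (1:ℝ≥0∞)) t
        + (Set.Ioc (-l-r) (-l)).indicator (fun _ => (1:ℝ≥0∞)) t := by
      intro t
      by_cases h1 : -l < t <;> by_cases h2 : t < l <;> by_cases h3 : -l < t + r <;>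
        by_cases h4 : t + r < l <;>
        simp [Set.indicator, h1, h2, h3, h4, sub_lt_iff_lt_add, lt_sub_iff_add_lt, ← not_lt] <;> linarith
    simp_rw [this]
    rw [lintegral_add_left (by fun_prop (disch := measurability)),
      lintegral_indicator measurableSet_Ico, lintegral_indicator measurableSet_Ioc,
      min_eq_left h.le]
    simp only [lintegral_const, Measure.restrict_apply_univ, Real.volume_Ico, Real.volume_Ioc, one_mul]
    rw [← ENNReal.ofReal_add (by linarith) (by linarith)]
    ring_nf

lemma aux_r (s m : ℝ) (hs : 0 < s) (hs' : s < 1/2) (hm : 0 ≤ m) :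
    ∫⁻ r in Set.Ioi (0:ℝ), ENNReal.ofReal (r ^ (-1 - 2*s)) * ENNReal.ofReal (2 * min r m)
      = ENNReal.ofReal (m ^ (1 - 2*s) / (s * (1 - 2*s))) := by
  rcases hm.eq_or_lt with rfl | hm
  · rw [setLIntegral_congr_fun (g := fun _ => 0) measurableSet_Ioi]
    · simp [Real.zero_rpow (by linarith : 1 - 2*s ≠ 0)]
    · intro r hr
      have hr : 0 < r := hr
      simp [min_eq_right hr.le]
  rw [← Set.Ioc_union_Ioi_eq_Ioi hm.le, lintegral_union measurableSet_Ioi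
    (Set.Ioc_disjoint_Ioi le_rfl)]
  have e1 : ∫⁻ r in Set.Ioc 0 m, ENNReal.ofReal (r ^ (-1 - 2*s)) * ENNReal.ofReal (2 * min r m)
      = ENNReal.ofReal (2 * (m ^ (1-2*s) / (1 - 2*s))) := by
    have hi : IntegrableOn (fun r : ℝ => 2 * r ^ (-2*s)) (Set.Ioc 0 m) := by
      apply Integrable.const_mul
      exact (intervalIntegrable_iff_integrableOn_Ioc_of_le hm.le).1
        (intervalIntegral.intervalIntegrable_rpow' (by linarith))
    have : ∫ r in Set.Ioc 0 m, 2 * r ^ (-2*s) = 2 * (m ^ (1-2*s) / (1 - 2*s)) := by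
      rw [integral_const_mul, ← intervalIntegral.integral_of_le hm.le, integral_rpow (Or.inl (by linarith)),
        Real.zero_rpow (by linarith)]
      ring_nf
    rw [← this, ofReal_integral_eq_lintegral_ofReal hi]
    · refine setLIntegral_congr_fun measurableSet_Ioc fun r hr => ?_
      have : 0 < r := hr.1
      rw [← ENNReal.ofReal_mul (by positivity), min_eq_left hr.2,
        show -2*s = (-1-2*s) + 1 by ring, Real.rpow_add_one this.ne']
      ring_nf
    · filter_upwards [ae_restrict_mem measurableSet_Ioc] with r hr
      have : 0 < r := hr.1
      positivity
  have e2 : ∫⁻ r in Set.Ioi m, ENNReal.ofReal (r ^ (-1 - 2*s)) * ENNReal.ofReal (2 * min r m)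
      = ENNReal.ofReal (m ^ (1-2*s) / s) := by
    have hi : IntegrableOn (fun r : ℝ => (2 * m) * r ^ (-1-2*s)) (Set.Ioi m) := by
      apply Integrable.const_mul
      exact integrableOn_Ioi_rpow_of_lt (by linarith) hm
    have : ∫ r in Set.Ioi m, (2 * m) * r ^ (-1-2*s) = m ^ (1-2*s) / s := by
      rw [integral_const_mul, integral_Ioi_rpow_of_lt (by linarith) hm,
        show 1 - 2*s = -(2*s)+1 by ring, Real.rpow_add_one hm.ne' (-(2*s))]
      have h : -1 - 2*s+1 = -(2*s) := by ring
      rw [h]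
      field_simp
    rw [← this, ofReal_integral_eq_lintegral_ofReal hi]
    · refine setLIntegral_congr_fun measurableSet_Ioi fun r hr => ?_
      have hr : m < r := hr
      have : 0 < r := hm.trans hr
      rw [← ENNReal.ofReal_mul (by positivity), min_eq_right hr.le]
      ring_nf
    · filter_upwards [ae_restrict_mem measurableSet_Ioi] with r hr
      have : 0 < r := hm.trans hr
      positivity
  have h12 : 0 < 1 - 2*s := by linarith
  rw [e1, e2, ← ENNReal.ofReal_add (by positivity) (by positivity)]
  congr 1
  field_simp
  ring

lemma aux_beta (n : ℕ) (hn : 1 ≤ n) (q : ℝ) (hq : 0 < q) :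
    ∫⁻ r in Set.Ioi (0:ℝ), ENNReal.ofReal (r ^ (n - 1)) * ENNReal.ofReal (√(1 - r^2) ^ q)
      = ENNReal.ofReal (ProbabilityTheory.beta (n/2) (q/2+1) / 2) := by
  have hn0 : (0:ℝ) < n := by exact_mod_cast hn
  have hα : (0:ℝ) < (n:ℝ)/2 := by positivity
  have hβ : (0:ℝ) < q/2+1 := by positivity
  have hb := ProbabilityTheory.beta_pos hα hβ
  set b := ProbabilityTheory.beta (n/2) (q/2+1)
  have h1 := ProbabilityTheory.lintegral_betaPDF_eq_one hα hβ
  rw [ProbabilityTheory.lintegral_betaPDF] at h1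
  have himg : (fun r : ℝ => r^2) '' Set.Ioo 0 1 = Set.Ioo 0 1 := by
    ext x
    constructor
    · rintro ⟨r, ⟨h0, h1⟩, rfl⟩
      exact ⟨by positivity, by simp only; nlinarith⟩
    · rintro ⟨h0, h1⟩
      exact ⟨√x, ⟨by positivity, by rw [Real.sqrt_lt' one_pos]; simpa using h1⟩, Real.sq_sqrt h0.le⟩
  rw [← himg, lintegral_image_eq_lintegral_abs_deriv_mul (f' := fun r => 2 * r) measurableSet_Ioo
    (fun x _ => by simpa using (hasDerivAt_pow 2 x).hasDerivWithinAt)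
    (fun x hx y hy h => by
      exact (pow_left_inj₀ hx.1.le hy.1.le two_ne_zero).1 h)] at h1
  have h2 : ∫⁻ r in Set.Ioi (0:ℝ), ENNReal.ofReal (r ^ (n - 1)) * ENNReal.ofReal (√(1 - r^2) ^ q)
      = ∫⁻ r in Set.Ioo (0:ℝ) 1, ENNReal.ofReal (r ^ (n - 1)) * ENNReal.ofReal (√(1 - r^2) ^ q) := by
    rw [← Set.Ioo_union_Ici_eq_Ioi one_pos, lintegral_union measurableSet_Ici
      (Set.disjoint_left.2 fun x hx hx' => absurd hx.2 (not_lt.2 hx'))]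
    rw [setLIntegral_eq_zero measurableSet_Ici, add_zero]
    intro x hx
    have hx : 1 ≤ x := hx
    have : √(1 - x^2) = 0 := Real.sqrt_eq_zero_of_nonpos (by nlinarith)
    simp [this, Real.zero_rpow hq.ne']
  rw [h2]
  have h3 : ∫⁻ r in Set.Ioo (0:ℝ) 1, ENNReal.ofReal (r ^ (n - 1)) * ENNReal.ofReal (√(1 - r^2) ^ q)
      = ENNReal.ofReal (b/2) * 1 := by
    rw [← h1, ← lintegral_const_mul' _ _ ENNReal.ofReal_ne_top]
    refine setLIntegral_congr_fun measurableSet_Ioo fun r hr => ?_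
    have h0 : 0 < r := hr.1
    have h01 : 0 < 1 - r^2 := by have := hr.2; nlinarith
    rw [← ENNReal.ofReal_mul (by positivity), ← ENNReal.ofReal_mul (by positivity),
      ← ENNReal.ofReal_mul (by positivity)]
    congr 1
    rw [abs_of_pos (by positivity), Real.sqrt_eq_rpow, ← Real.rpow_mul h01.le,
      ← Real.rpow_natCast r 2, ← Real.rpow_mul h0.le, ← Real.rpow_natCast r (n-1),
      Nat.cast_sub hn]
    have : r ^ ((n:ℝ) - (1:ℕ)) = r * r ^ (((2:ℕ):ℝ) * ((n:ℝ)/2 - 1)) := by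
      rw [mul_comm, ← Real.rpow_add_one h0.ne']
      congr 1; push_cast; ring
    rw [this, show q/2+1-1 = 1/2*q by ring]
    change _ = b/2 * (2*r*(1/b * _ * _))
    field_simp
  rw [h3, mul_one]

lemma aux_V (n : ℕ) (h : EuclideanSpace ℝ (Fin (n+1))) :
    ∫⁻ x : EuclideanSpace ℝ (Fin (n+1)), ENNReal.ofReal
      (|(Metric.ball (0 : EuclideanSpace ℝ (Fin (n+1))) 1).indicator (fun _ => (1 : ℝ)) x
        - (Metric.ball (0 : EuclideanSpace ℝ (Fin (n+1))) 1).indicator (fun _ => (1 : ℝ)) (x + h)| ^ 2)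
    = ∫⁻ z : EuclideanSpace ℝ (Fin n), ENNReal.ofReal (2 * min ‖h‖ (2 * √(1 - ‖z‖^2))) := by
  set B := Metric.ball (0 : EuclideanSpace ℝ (Fin (n+1))) 1 with hB
  have hind : Measurable (B.indicator (fun _ => (1:ℝ))) :=
    measurable_const.indicator Metric.isOpen_ball.measurableSet
  have hmeas : ∀ h, Measurable fun x => ENNReal.ofReal
      (|B.indicator (fun _ => (1 : ℝ)) x - B.indicator (fun _ => (1 : ℝ)) (x + h)| ^ 2) := by
    intro h
    have : Measurable fun x => B.indicator (fun _ => (1 : ℝ)) (x + h) :=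
      hind.comp (measurable_id.add_const h)
    fun_prop
  set w : EuclideanSpace ℝ (Fin (n+1)) := EuclideanSpace.single 0 ‖h‖ with hw
  have hnorm : ‖w‖ = ‖h‖ := by simp [hw]
  let L := (Submodule.span ℝ {w - h})ᗮ.reflection
  have hL : L w = h := Submodule.reflection_sub hnorm
  have hBL : ∀ x, B.indicator (fun _ => (1:ℝ)) (L x) = B.indicator (fun _ => (1:ℝ)) x := by
    intro x
    simp [Set.indicator, hB]
  rw [← L.measurePreserving.lintegral_comp (hmeas h)]
  have : ∀ x, B.indicator (fun _ => (1:ℝ)) (L x + h) = B.indicator (fun _ => (1:ℝ)) (x + w) := by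
    intro x
    rw [← hL, ← map_add, hBL]
  simp_rw [this, hBL]
  rw [aux_slice n _ (hmeas w)]
  refine lintegral_congr fun z => ?_
  rw [← aux_interval (1 - ‖z‖^2) ‖h‖ (norm_nonneg h)]
  refine lintegral_congr fun t => ?_
  have key : ∀ t : ℝ, B.indicator (fun _ => (1:ℝ)) (WithLp.toLp 2 (Fin.cons t z.ofLp)) =
      {t : ℝ | t^2 < 1 - ‖z‖^2}.indicator (fun _ => (1:ℝ)) t := by
    intro t
    have : (WithLp.toLp 2 (Fin.cons t z.ofLp) : EuclideanSpace ℝ (Fin (n+1))) ∈ B ↔ t^2 < 1 - ‖z‖^2 := by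
      rw [hB, mem_ball_zero_iff, ← sq_lt_one_iff₀ (norm_nonneg _), EuclideanSpace.norm_sq_eq,
        EuclideanSpace.norm_sq_eq, Fin.sum_univ_succ]
      simp [lt_sub_iff_add_lt]
    simp [Set.indicator, this]
  have hadd : (WithLp.toLp 2 (Fin.cons t z.ofLp) : EuclideanSpace ℝ (Fin (n+1))) + w =
      WithLp.toLp 2 (Fin.cons (t + ‖h‖) z.ofLp) := by
    ext i
    refine Fin.cases ?_ (fun i => ?_) i <;> simp [hw]
  rw [hadd, key, key]

lemma aux_const (n : ℕ) (hn : 1 ≤ n) (s : ℝ) (hs : 0 < s) (hs' : s < 1 / 2) :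
    ((n+1 : ℕ) : ℝ) * (√π ^ (n+1) / Gamma (((n+1 : ℕ) : ℝ) / 2 + 1)) *
      ((2 ^ (1 - 2*s) / (s * (1 - 2*s))) * (n * (√π ^ n / Gamma ((n : ℝ) / 2 + 1)) *
        (ProbabilityTheory.beta (n/2) ((1-2*s)/2+1) / 2)))
    = (n+1 : ℕ) * π ^ (n+1) * Gamma (1 - 2 * s)
          / (s * Gamma (((n+1 : ℕ) : ℝ) / 2 + 1) * Gamma (1 - s)
              * Gamma ((((n+1 : ℕ) : ℝ) + 2 - 2 * s) / 2)) := by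
  have hn0 : (0:ℝ) < n := by exact_mod_cast hn
  have h12 : 0 < 1 - 2*s := by linarith
  have hd := Real.Gamma_mul_Gamma_add_half (1/2 - s)
  rw [show 1/2 - s + 1/2 = 1 - s by ring, show 2 * (1/2 - s) = 1 - 2*s by ring,
    show 1 - (1 - 2*s) = 2*s by ring] at hd
  have g1 : Gamma ((1-2*s)/2+1) = (1-2*s)/2 * Gamma (1/2 - s) := by
    rw [Real.Gamma_add_one (by positivity)]
    congr 2; ring
  have g2 : Gamma ((n:ℝ)/2+1) = n/2 * Gamma ((n:ℝ)/2) := Real.Gamma_add_one (by positivity)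
  have g3 : (n:ℝ)/2 + ((1-2*s)/2+1) = (((n+1 : ℕ) : ℝ) + 2 - 2 * s) / 2 := by push_cast; ring
  have p1 : 0 < Gamma ((n:ℝ)/2) := Real.Gamma_pos_of_pos (by positivity)
  have p2 : 0 < Gamma (1 - s) := Real.Gamma_pos_of_pos (by linarith)
  have p3 : 0 < Gamma (((n+1 : ℕ) : ℝ) / 2 + 1) := Real.Gamma_pos_of_pos (by positivity)
  have p4 : 0 < Gamma ((((n+1 : ℕ) : ℝ) + 2 - 2 * s) / 2) := by
    rw [← g3]; exact Real.Gamma_pos_of_pos (by positivity)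
  have e2 : (2:ℝ) ^ (1 - 2*s) * 2 ^ (2*s) = 2 := by
    rw [← Real.rpow_add two_pos]; norm_num
  have hsq : √π ^ (n+1) * √π ^ n * √π = π ^ (n+1) := by
    rw [← pow_add, ← pow_succ, show n+1+n+1 = 2*(n+1) by ring, pow_mul, Real.sq_sqrt pi_pos.le]
  have hG : Gamma (1/2 - s) = Gamma (1 - 2*s) * 2 ^ (2*s) * √π / Gamma (1 - s) := by
    rw [eq_div_iff p2.ne', hd]
  rw [ProbabilityTheory.beta, g3, g1, g2, hG, ← hsq]
  have e3 : (2:ℝ) ^ (1 - 2*s) = 2 / 2 ^ (2*s) := by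
    rw [eq_div_iff (by positivity), e2]
  rw [e3]
  have : (0:ℝ) < 2 ^ (2*s) := by positivity
  generalize (2:ℝ) ^ (2*s) = c at *
  generalize Gamma ((((n+1 : ℕ) : ℝ) + 2 - 2 * s) / 2) = G1 at *
  generalize Gamma (((n+1 : ℕ) : ℝ) / 2 + 1) = G2 at *
  generalize Gamma (1 - 2*s) = G3 at *
  field_simp

theorem fracPerimeter_ball (N : ℕ) (hN : 2 ≤ N) (s : ℝ) (hs : 0 < s) (hs' : s < 1 / 2) :
    fracPerimeter N s (Metric.ball (0 : EuclideanSpace ℝ (Fin N)) 1)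
    = ENNReal.ofReal
        (N * π ^ (N : ℕ) * Gamma (1 - 2 * s)
          / (s * Gamma ((N : ℝ) / 2 + 1) * Gamma (1 - s)
              * Gamma (((N : ℝ) + 2 - 2 * s) / 2))) := by
  obtain ⟨n, rfl⟩ : ∃ n, N = n + 1 := ⟨N - 1, by omega⟩
  have hn : 1 ≤ n := by omega
  have h12 : 0 < 1 - 2*s := by linarith
  unfold fracPerimeter
  set B := Metric.ball (0 : EuclideanSpace ℝ (Fin (n+1))) 1 with hB
  have hind : Measurable (B.indicator (fun _ => (1:ℝ))) :=
    measurable_const.indicator Metric.isOpen_ball.measurableSet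
  -- translate and swap
  have s1 : ∀ x, ∫⁻ y, ENNReal.ofReal
      (|B.indicator (fun _ => (1 : ℝ)) x - B.indicator (fun _ => (1 : ℝ)) y| ^ 2
        / ‖x - y‖ ^ (((n+1 : ℕ) : ℝ) + 2 * s)) =
      ∫⁻ h, ENNReal.ofReal (‖h‖ ^ (-(((n+1 : ℕ) : ℝ) + 2 * s))) * ENNReal.ofReal
      (|B.indicator (fun _ => (1 : ℝ)) x - B.indicator (fun _ => (1 : ℝ)) (x + h)| ^ 2) := by
    intro x
    rw [← lintegral_add_left_eq_self _ x]
    refine lintegral_congr fun h => ?_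
    rw [← ENNReal.ofReal_mul (by positivity), Real.rpow_neg (norm_nonneg h)]
    congr 1
    rw [show x - (x + h) = -h by abel, norm_neg]
    ring
  simp_rw [s1]
  have hm : Measurable fun p : EuclideanSpace ℝ (Fin (n+1)) × EuclideanSpace ℝ (Fin (n+1)) =>
      ENNReal.ofReal (‖p.2‖ ^ (-(((n+1 : ℕ) : ℝ) + 2 * s))) * ENNReal.ofReal
      (|B.indicator (fun _ => (1 : ℝ)) p.1 - B.indicator (fun _ => (1 : ℝ)) (p.1 + p.2)| ^ 2) := by
    have h1 : Measurable fun p : EuclideanSpace ℝ (Fin (n+1)) × EuclideanSpace ℝ (Fin (n+1)) =>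
      B.indicator (fun _ => (1 : ℝ)) p.1 := hind.comp measurable_fst
    have h2 : Measurable fun p : EuclideanSpace ℝ (Fin (n+1)) × EuclideanSpace ℝ (Fin (n+1)) =>
      B.indicator (fun _ => (1 : ℝ)) (p.1 + p.2) := hind.comp (measurable_fst.add measurable_snd)
    fun_prop
  rw [lintegral_lintegral_swap hm.aemeasurable]
  simp_rw [lintegral_const_mul' _ _ ENNReal.ofReal_ne_top]
  simp_rw [hB, aux_V n]
  -- radial integration
  have hm2 : Measurable fun p : ℝ × EuclideanSpace ℝ (Fin n) =>
      ENNReal.ofReal (2 * min p.1 (2 * √(1 - ‖p.2‖^2))) := by fun_prop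
  have hm3 : Measurable fun r : ℝ => ∫⁻ z : EuclideanSpace ℝ (Fin n),
      ENNReal.ofReal (2 * min r (2 * √(1 - ‖z‖^2))) := hm2.lintegral_prod_right'
  rw [aux_radial (n+1) (by omega) (fun r => ENNReal.ofReal (r ^ (-(((n+1 : ℕ) : ℝ) + 2 * s))) *
    ∫⁻ z : EuclideanSpace ℝ (Fin n), ENNReal.ofReal (2 * min r (2 * √(1 - ‖z‖^2)))) (by fun_prop)]
  have s2 : ∫⁻ r in Set.Ioi (0:ℝ), ENNReal.ofReal (r ^ (n + 1 - 1)) *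
      (ENNReal.ofReal (r ^ (-(((n+1 : ℕ) : ℝ) + 2 * s))) *
    ∫⁻ z : EuclideanSpace ℝ (Fin n), ENNReal.ofReal (2 * min r (2 * √(1 - ‖z‖^2)))) =
      ∫⁻ r in Set.Ioi (0:ℝ), ∫⁻ z : EuclideanSpace ℝ (Fin n), ENNReal.ofReal (r ^ (-1 - 2*s)) *
        ENNReal.ofReal (2 * min r (2 * √(1 - ‖z‖^2))) := by
    refine setLIntegral_congr_fun measurableSet_Ioi fun r hr => ?_
    have hr : 0 < r := hr
    rw [lintegral_const_mul' _ _ ENNReal.ofReal_ne_top, ← mul_assoc,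
      ← ENNReal.ofReal_mul (by positivity), ← Real.rpow_natCast, ← Real.rpow_add hr]
    congr 3
    push_cast [Nat.add_sub_cancel]
    ring
  rw [s2, lintegral_lintegral_swap (by fun_prop)]
  have s3 : ∀ z : EuclideanSpace ℝ (Fin n),
      ∫⁻ r in Set.Ioi (0:ℝ), ENNReal.ofReal (r ^ (-1 - 2*s)) *
        ENNReal.ofReal (2 * min r (2 * √(1 - ‖z‖^2))) =
      ENNReal.ofReal (2 ^ (1 - 2*s) / (s * (1 - 2*s))) * ENNReal.ofReal (√(1 - ‖z‖^2) ^ (1 - 2*s)) := by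
    intro z
    rw [aux_r s _ hs hs' (by positivity), ← ENNReal.ofReal_mul (by positivity),
      Real.mul_rpow (by norm_num) (by positivity)]
    congr 1
    ring
  simp_rw [s3]
  rw [lintegral_const_mul' _ _ ENNReal.ofReal_ne_top,
    aux_radial n hn (fun r => ENNReal.ofReal (√(1 - r^2) ^ (1 - 2*s))) (by fun_prop),
    aux_beta n hn _ h12]
  have : Nonempty (Fin n) := ⟨⟨0, hn⟩⟩
  rw [EuclideanSpace.volume_ball, EuclideanSpace.volume_ball]
  simp only [ENNReal.ofReal_one, one_pow, one_mul, Fintype.card_fin]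
  have hbp := ProbabilityTheory.beta_pos (α := n/2) (β := (1-2*s)/2+1)
    (by have : (0:ℝ) < n := by exact_mod_cast hn
        positivity) (by positivity)
  have hg1 : 0 ≤ √π ^ (n+1) / Gamma (((n+1 : ℕ) : ℝ) / 2 + 1) :=
    div_nonneg (by positivity) (Real.Gamma_pos_of_pos (by positivity)).le
  have hg2 : 0 ≤ √π ^ n / Gamma ((n : ℝ) / 2 + 1) :=
    div_nonneg (by positivity) (Real.Gamma_pos_of_pos (by positivity)).le
  rw [← aux_const n hn s hs hs', ← ENNReal.ofReal_natCast n, ← ENNReal.ofReal_natCast (n+1)]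
  rw [← ENNReal.ofReal_mul (by positivity), ← ENNReal.ofReal_mul (by positivity),
    ← ENNReal.ofReal_mul (by positivity), ← ENNReal.ofReal_mul (by positivity),
    ← ENNReal.ofReal_mul (by positivity)]
end

section
/- Let N ≥ 2 and 0 < s < 1/2. For every measurable set E ⊂ ℝ^N with |E| < ∞ one has the fractional isoperimetric inequality with sharp explicit constant: P_s(E) ≥ ( N · π^(N/2 + s) · Γ(1-2s) / ( s · Γ(N/2 + 1)^(2s/N) · Γ(1-s) · Γ((N+2-2s)/2) ) ) · |E|^((N-2s)/N). -/
open MeasureTheory Real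
open scoped ENNReal

section Polarization

set_option linter.unusedSectionVars false

variable {V : Type*} [NormedAddCommGroup V] [InnerProductSpace ℝ V]

/-- Reflection across the affine hyperplane `⟪x, u⟫ = t`. -/
noncomputable def hrefl (u : V) (t : ℝ) (x : V) : V := x - (2 * (inner ℝ x u - t)) • u

lemma inner_hrefl {u : V} (hu : ‖u‖ = 1) (t : ℝ) (x : V) :
    inner ℝ (hrefl u t x) u = 2 * t - inner ℝ x u := by
  simp only [hrefl, inner_sub_left, real_inner_smul_left, real_inner_self_eq_norm_sq, hu]
  ring

lemma hrefl_hrefl {u : V} (hu : ‖u‖ = 1) (t : ℝ) (x : V) : hrefl u t (hrefl u t x) = x := by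
  have := inner_hrefl hu t x
  rw [hrefl, this, hrefl]
  module

lemma hrefl_eq_self {u : V} {t : ℝ} {x : V} (h : inner ℝ x u = t) : hrefl u t x = x := by
  simp [hrefl, h]

lemma hrefl_neg (u : V) (t : ℝ) (x : V) : hrefl (-u) (-t) x = hrefl u t x := by
  simp only [hrefl, inner_neg_right]
  module

lemma norm_sub_hrefl_sq {u : V} (hu : ‖u‖ = 1) (t : ℝ) (x y : V) :
    ‖x - hrefl u t y‖ ^ 2 = ‖x - y‖ ^ 2 + 4 * (inner ℝ y u - t) * (inner ℝ x u - t) := by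
  have : x - hrefl u t y = (x - y) + (2 * (inner ℝ y u - t)) • u := by
    rw [hrefl]; module
  rw [this, norm_add_sq_real, norm_smul, hu, real_inner_smul_right, inner_sub_left, mul_one,
    Real.norm_eq_abs, sq_abs]
  ring

lemma norm_hrefl_sub_hrefl {u : V} (hu : ‖u‖ = 1) (t : ℝ) (x y : V) :
    ‖hrefl u t x - hrefl u t y‖ = ‖x - y‖ := by
  have h1 := norm_sub_hrefl_sq hu t (hrefl u t x) y
  have h2 := norm_sub_hrefl_sq hu t y x
  rw [inner_hrefl hu, norm_sub_rev, norm_sub_rev (hrefl u t x) y] at h1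
  rw [← sq_eq_sq₀ (norm_nonneg _) (norm_nonneg _), norm_sub_rev, h1, h2, norm_sub_rev x y]
  ring

lemma norm_hrefl_sq {u : V} (hu : ‖u‖ = 1) (t : ℝ) (x : V) :
    ‖hrefl u t x‖ ^ 2 = ‖x‖ ^ 2 - 4 * (inner ℝ x u - t) * t := by
  have := norm_sub_hrefl_sq hu t 0 x
  simp only [zero_sub, norm_neg, inner_zero_left] at this
  rw [this]; ring

variable [FiniteDimensional ℝ V] [MeasurableSpace V] [BorelSpace V]

lemma measurable_hrefl (u : V) (t : ℝ) : Measurable (hrefl u t) := by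
  unfold hrefl; fun_prop

lemma measurePreserving_hrefl {u : V} (hu : ‖u‖ = 1) (t : ℝ) :
    MeasurePreserving (hrefl u t) (volume : Measure V) volume := by
  have h1 := ((ℝ ∙ u)ᗮ.reflection).measurePreserving
  have h2 := measurePreserving_add_right (volume : Measure V) ((2 * t) • u)
  have : hrefl u t = (fun x => x + (2 * t) • u) ∘ (ℝ ∙ u)ᗮ.reflection := by
    funext x
    rw [Function.comp_apply, Submodule.reflection_orthogonal_apply,
      Submodule.reflection_singleton_apply, hrefl, hu, real_inner_comm]
    simp only [RCLike.ofReal_real_eq_id, id, one_pow, div_one]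
    module
  rw [this]
  exact h2.comp h1

/-- Polarization of a set. -/
def polar (u : V) (t : ℝ) (F : Set V) : Set V :=
  {x | (inner ℝ x u ≤ t ∧ (x ∈ F ∨ hrefl u t x ∈ F)) ∨ (x ∈ F ∧ hrefl u t x ∈ F)}

lemma measurableSet_polar (u : V) (t : ℝ) {F : Set V} (hF : MeasurableSet F) :
    MeasurableSet (polar u t F) := by
  have h1 : MeasurableSet {x : V | inner ℝ x u ≤ t} :=
    measurableSet_le (by fun_prop) measurable_const
  have h2 := measurable_hrefl u t hF
  exact (h1.inter (hF.union h2)).union (hF.inter h2)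

/-- The kernel, infinite on the diagonal. -/
noncomputable def kern (p : ℝ) (x y : V) : ℝ≥0∞ := (ENNReal.ofReal ‖x - y‖) ^ (-p)

open Classical in
/-- Weighted disagreement. -/
noncomputable def dis (F : Set V) (x y : V) : ℝ≥0∞ := if (x ∈ F ↔ y ∈ F) then 0 else 1

/-- The energy. -/
noncomputable def energy (p : ℝ) (F : Set V) : ℝ≥0∞ :=
  ∫⁻ z : V × V, kern p z.1 z.2 * dis F z.1 z.2 ∂(volume.prod volume)

lemma measurable_kern (p : ℝ) : Measurable (fun z : V × V => kern p z.1 z.2) := by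
  unfold kern; fun_prop

lemma measurable_dis {F : Set V} (hF : MeasurableSet F) :
    Measurable (fun z : V × V => dis F z.1 z.2) := by
  unfold dis
  refine Measurable.ite ?_ measurable_const measurable_const
  have h1 : MeasurableSet {z : V × V | z.1 ∈ F} := measurable_fst hF
  have h2 : MeasurableSet {z : V × V | z.2 ∈ F} := measurable_snd hF
  exact h1.iff h2

lemma kern_le {p : ℝ} (hp : 0 ≤ p) {x y x' y' : V} (h : ‖x - y‖ ≤ ‖x' - y'‖) :
    kern p x' y' ≤ kern p x y := by
  unfold kern
  rw [ENNReal.rpow_neg, ENNReal.rpow_neg]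
  gcongr

open Classical in
/-- Disagreement of propositions. -/
noncomputable def pd (P Q : Prop) : ℝ≥0∞ := if (P ↔ Q) then 0 else 1

lemma comb {a b : ℝ≥0∞} (h : b ≤ a) (P P' Q Q' : Prop) :
    a * (pd (P ∨ P') (Q ∨ Q') + pd (P ∧ P') (Q ∧ Q'))
      + b * (pd (P ∨ P') (Q ∧ Q') + pd (P ∧ P') (Q ∨ Q')) ≤
    a * (pd P Q + pd P' Q') + b * (pd P Q' + pd P' Q) := by
  unfold pd
  by_cases c1 : P <;> by_cases c2 : P' <;> by_cases c3 : Q <;>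
      by_cases c4 : Q' <;> simp [c1, c2, c3, c4, add_comm] <;> gcongr

lemma mem_polar_le {u : V} (hu : ‖u‖ = 1) {t : ℝ} (F : Set V) {x : V} (h : inner ℝ x u ≤ t) :
    (x ∈ polar u t F ↔ (x ∈ F ∨ hrefl u t x ∈ F)) ∧
    (hrefl u t x ∈ polar u t F ↔ (x ∈ F ∧ hrefl u t x ∈ F)) := by
  have e : (2 * t - inner ℝ x u ≤ t) ↔ t ≤ inner ℝ x u := by constructor <;> intro <;> linarith
  simp only [polar, Set.mem_ofPred_eq, hrefl_hrefl hu, inner_hrefl hu, e]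
  rcases h.lt_or_eq with h1 | h1
  · have := not_le.2 h1
    tauto
  · rw [hrefl_eq_self h1]
    tauto

lemma mem_polar_ge {u : V} (hu : ‖u‖ = 1) {t : ℝ} (F : Set V) {x : V} (h : t ≤ inner ℝ x u) :
    (x ∈ polar u t F ↔ (x ∈ F ∧ hrefl u t x ∈ F)) ∧
    (hrefl u t x ∈ polar u t F ↔ (x ∈ F ∨ hrefl u t x ∈ F)) := by
  have := mem_polar_le hu (t := t) F (x := hrefl u t x) (by rw [inner_hrefl hu]; linarith)
  rw [hrefl_hrefl hu] at this
  exact ⟨this.2.trans and_comm, this.1.trans or_comm⟩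

lemma four_point {p : ℝ} (hp : 0 ≤ p) {u : V} (hu : ‖u‖ = 1) (t : ℝ) (F : Set V) (x y : V) :
    kern p x y * (dis (polar u t F) x y + dis (polar u t F) (hrefl u t x) (hrefl u t y))
      + kern p x (hrefl u t y) * (dis (polar u t F) x (hrefl u t y)
        + dis (polar u t F) (hrefl u t x) y) ≤
    kern p x y * (dis F x y + dis F (hrefl u t x) (hrefl u t y))
      + kern p x (hrefl u t y) * (dis F x (hrefl u t y) + dis F (hrefl u t x) y) := by
  have hxy := norm_sub_hrefl_sq hu t x y
  have hx' := inner_hrefl hu t x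
  have hy' := inner_hrefl hu t y
  have key1 : 0 ≤ (inner ℝ y u - t) * (inner ℝ x u - t) →
      kern p x (hrefl u t y) ≤ kern p x y := fun h => kern_le hp
    (by rw [← sq_le_sq₀ (norm_nonneg _) (norm_nonneg _)]; nlinarith)
  have key2 : (inner ℝ y u - t) * (inner ℝ x u - t) ≤ 0 →
      kern p x y ≤ kern p x (hrefl u t y) := fun h => kern_le hp
    (by rw [← sq_le_sq₀ (norm_nonneg _) (norm_nonneg _)]; nlinarith)
  have e : ∀ (F : Set V) x y, dis F x y = pd (x ∈ F) (y ∈ F) := fun _ _ _ => rfl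
  simp only [e]
  rcases le_total (inner ℝ x u) t with h1 | h1 <;>
  rcases le_total (inner ℝ y u) t with h2 | h2
  · rw [(mem_polar_le hu F h1).1, (mem_polar_le hu F h1).2, (mem_polar_le hu F h2).1,
      (mem_polar_le hu F h2).2]
    exact comb (key1 (by nlinarith)) _ _ _ _
  · rw [(mem_polar_le hu F h1).1, (mem_polar_le hu F h1).2, (mem_polar_ge hu F h2).1,
      (mem_polar_ge hu F h2).2]
    have := comb (key2 (by nlinarith)) (x ∈ F) (hrefl u t x ∈ F) (y ∈ F) (hrefl u t y ∈ F)
    have h3 := comb (key2 (by nlinarith)) (x ∈ F) (hrefl u t x ∈ F) (hrefl u t y ∈ F) (y ∈ F)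
    rw [add_comm] at h3
    rw [add_comm (kern p x y * (pd (x ∈ F) (y ∈ F) + _))]
    simpa only [or_comm, and_comm] using h3
  · rw [(mem_polar_ge hu F h1).1, (mem_polar_ge hu F h1).2, (mem_polar_le hu F h2).1,
      (mem_polar_le hu F h2).2]
    have h3 := comb (key2 (by nlinarith)) (x ∈ F) (hrefl u t x ∈ F) (hrefl u t y ∈ F) (y ∈ F)
    have e2 : ∀ a b c d e f : ℝ≥0∞, a * (b + c) + d * (e + f) = d * (f + e) + a * (c + b) := by
      intros; ring
    rw [e2, add_comm (kern p x y * (pd (x ∈ F) (y ∈ F) + _))]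
    simpa only [or_comm, and_comm] using h3
  · rw [(mem_polar_ge hu F h1).1, (mem_polar_ge hu F h1).2, (mem_polar_ge hu F h2).1,
      (mem_polar_ge hu F h2).2]
    have h3 := comb (key1 (by nlinarith)) (x ∈ F) (hrefl u t x ∈ F) (y ∈ F) (hrefl u t y ∈ F)
    rw [add_comm (pd (_ ∧ _) _), add_comm (pd (_ ∧ _) (_ ∨ _))]
    exact h3

lemma energy_four {p : ℝ} {u : V} (hu : ‖u‖ = 1) (t : ℝ) {F : Set V} (hF : MeasurableSet F) :
    4 * energy p F = ∫⁻ z : V × V, (kern p z.1 z.2 *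
        (dis F z.1 z.2 + dis F (hrefl u t z.1) (hrefl u t z.2))
      + kern p z.1 (hrefl u t z.2) * (dis F z.1 (hrefl u t z.2) + dis F (hrefl u t z.1) z.2))
      ∂(volume.prod volume) := by
  have hm := measurePreserving_hrefl hu t
  have hi := MeasurePreserving.id (volume : Measure V)
  have hk : Measurable (fun z : V × V => kern p z.1 z.2 * dis F z.1 z.2) :=
    (measurable_kern p).mul (measurable_dis hF)
  have h1 := (hm.prod hm).lintegral_comp hk
  have h2 := (hi.prod hm).lintegral_comp hk
  have h3 := (hm.prod hi).lintegral_comp hk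
  have m1 := hk.comp (hm.prod hm).measurable
  have m2 := hk.comp (hi.prod hm).measurable
  have m3 := hk.comp (hm.prod hi).measurable
  have e1 : ∀ x y : V, kern p (hrefl u t x) (hrefl u t y) = kern p x y := by
    intro x y; rw [kern, norm_hrefl_sub_hrefl hu, kern]
  have e2 : ∀ x y : V, kern p (hrefl u t x) y = kern p x (hrefl u t y) := by
    intro x y; rw [← e1 x, hrefl_hrefl hu]
  simp only [Function.comp_def, Prod.map, id] at h1 h2 h3 m1 m2 m3
  simp only [e1, e2] at h1 h2 h3 m1 m2 m3
  have e : (∫⁻ z : V × V, (kern p z.1 z.2 *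
        (dis F z.1 z.2 + dis F (hrefl u t z.1) (hrefl u t z.2))
      + kern p z.1 (hrefl u t z.2) * (dis F z.1 (hrefl u t z.2) + dis F (hrefl u t z.1) z.2))
      ∂(volume.prod volume)) = energy p F + energy p F + energy p F + energy p F := by
    nth_rewrite 2 [← (show _ = energy p F from h1)]
    nth_rewrite 2 [← (show _ = energy p F from h2)]
    nth_rewrite 2 [← (show _ = energy p F from h3)]
    rw [energy, ← lintegral_add_right _ m1, ← lintegral_add_right _ m2, ← lintegral_add_right _ m3]
    congr 1
    funext z
    ring
  rw [e]
  ring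

lemma energy_polar_le {p : ℝ} (hp : 0 ≤ p) {u : V} (hu : ‖u‖ = 1) (t : ℝ) {F : Set V}
    (hF : MeasurableSet F) : energy p (polar u t F) ≤ energy p F := by
  have h : 4 * energy p (polar u t F) ≤ 4 * energy p F := by
    rw [energy_four hu t hF, energy_four hu t (measurableSet_polar u t hF)]
    exact lintegral_mono fun z => four_point hp hu t F z.1 z.2
  exact (ENNReal.mul_le_mul_iff_right (by norm_num) (by norm_num)).1 h


open Classical in
/-- Count of a proposition. -/
noncomputable def cnt (P : Prop) : ℝ≥0∞ := if P then 1 else 0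

lemma measurable_cnt {G : Set V} (hG : MeasurableSet G) : Measurable (fun x => cnt (x ∈ G)) := by
  unfold cnt
  exact Measurable.ite hG measurable_const measurable_const

lemma lintegral_cnt {G : Set V} (hG : MeasurableSet G) :
    ∫⁻ x, cnt (x ∈ G) = volume G := by
  rw [← lintegral_indicator_one hG]
  rfl

lemma two_volume {u : V} (hu : ‖u‖ = 1) (t : ℝ) {G : Set V} (hG : MeasurableSet G) :
    2 * volume G = ∫⁻ x, (cnt (x ∈ G) + cnt (hrefl u t x ∈ G)) := by
  have h1 := (measurePreserving_hrefl hu t).lintegral_comp (measurable_cnt hG)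
  rw [lintegral_add_left (measurable_cnt hG), h1, lintegral_cnt hG]
  ring

lemma volume_polar {u : V} (hu : ‖u‖ = 1) (t : ℝ) {F : Set V} (hF : MeasurableSet F) :
    volume (polar u t F) = volume F := by
  have h : 2 * volume (polar u t F) = 2 * volume F := by
    rw [two_volume hu t hF, two_volume hu t (measurableSet_polar u t hF)]
    congr 1
    funext x
    rcases le_total (inner ℝ x u) t with h1 | h1
    · rw [(mem_polar_le hu F h1).1, (mem_polar_le hu F h1).2]
      by_cases c1 : x ∈ F <;> by_cases c2 : hrefl u t x ∈ F <;> simp [cnt, c1, c2]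
    · rw [(mem_polar_ge hu F h1).1, (mem_polar_ge hu F h1).2]
      by_cases c1 : x ∈ F <;> by_cases c2 : hrefl u t x ∈ F <;> simp [cnt, c1, c2]
  exact (ENNReal.mul_right_inj (by norm_num) (by norm_num)).1 h

lemma volume_polar_inter {u : V} (hu : ‖u‖ = 1) {t : ℝ} (ht : 0 ≤ t) {F : Set V}
    (hF : MeasurableSet F) (r : ℝ) :
    volume (F ∩ Metric.ball 0 r) +
      volume {x | x ∈ F \ Metric.ball 0 r ∧ hrefl u t x ∈ Metric.ball 0 r \ F} ≤
      volume (polar u t F ∩ Metric.ball 0 r) := by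
  have hB : MeasurableSet (Metric.ball (0 : V) r) := Metric.isOpen_ball.measurableSet
  have hG : MeasurableSet {x | x ∈ F \ Metric.ball 0 r ∧ hrefl u t x ∈ Metric.ball 0 r \ F} :=
    (hF.diff hB).inter (measurable_hrefl u t (hB.diff hF))
  have h : 2 * (volume (F ∩ Metric.ball 0 r) +
      volume {x | x ∈ F \ Metric.ball 0 r ∧ hrefl u t x ∈ Metric.ball 0 r \ F}) ≤
      2 * volume (polar u t F ∩ Metric.ball 0 r) := by
    rw [mul_add, two_volume hu t (hF.inter hB), two_volume hu t hG,
      two_volume hu t ((measurableSet_polar u t hF).inter hB), ← lintegral_add_left]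
    swap
    · exact (measurable_cnt (hF.inter hB)).add
        ((measurable_cnt (hF.inter hB)).comp (measurable_hrefl u t))
    refine lintegral_mono fun x => ?_
    have hn := norm_hrefl_sq hu t x
    simp only [Set.mem_inter_iff, Set.mem_sdiff, Set.mem_ofPred_eq, hrefl_hrefl hu]
    rcases le_total (inner ℝ x u) t with h1 | h1
    · rw [(mem_polar_le hu F h1).1, (mem_polar_le hu F h1).2]
      have hb : hrefl u t x ∈ Metric.ball 0 r → x ∈ Metric.ball 0 r := by
        simp only [mem_ball_zero_iff]
        refine fun h => lt_of_le_of_lt ?_ h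
        rw [← sq_le_sq₀ (norm_nonneg _) (norm_nonneg _)]; nlinarith
      by_cases c1 : x ∈ F <;> by_cases c2 : hrefl u t x ∈ F <;>
        by_cases c3 : x ∈ Metric.ball 0 r <;> by_cases c4 : hrefl u t x ∈ Metric.ball 0 r <;>
        simp [-Metric.mem_ball, cnt, c1, c2, c3, c4] <;> exact c3 (hb c4)
    · rw [(mem_polar_ge hu F h1).1, (mem_polar_ge hu F h1).2]
      have hb : x ∈ Metric.ball 0 r → hrefl u t x ∈ Metric.ball 0 r := by
        simp only [mem_ball_zero_iff]
        refine fun h => lt_of_le_of_lt ?_ h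
        rw [← sq_le_sq₀ (norm_nonneg _) (norm_nonneg _)]; nlinarith
      by_cases c1 : x ∈ F <;> by_cases c2 : hrefl u t x ∈ F <;>
        by_cases c3 : x ∈ Metric.ball 0 r <;> by_cases c4 : hrefl u t x ∈ Metric.ball 0 r <;>
        simp [-Metric.mem_ball, cnt, c1, c2, c3, c4] <;> exact c4 (hb c3)
  exact (ENNReal.mul_le_mul_iff_right (by norm_num) (by norm_num)).1 h

end Polarization

section Averaging

set_option linter.unusedSectionVars false

variable {V : Type*} [NormedAddCommGroup V] [InnerProductSpace ℝ V]
variable [FiniteDimensional ℝ V] [MeasurableSpace V] [BorelSpace V]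

lemma lintegral_polar_coord [Nontrivial V] {f : V → ℝ≥0∞} (hf : Measurable f) :
    ∫⁻ v, f v = ∫⁻ u : Metric.sphere (0 : V) 1, (∫⁻ r in Set.Ioi (0 : ℝ),
      ENNReal.ofReal (r ^ (Module.finrank ℝ V - 1)) * f (r • (u : V)))
      ∂(volume : Measure V).toSphere := by
  have h1 := (volume : Measure V).measurePreserving_homeomorphUnitSphereProd
  have hm : Measurable (fun z : Metric.sphere (0 : V) 1 × Set.Ioi (0 : ℝ) =>
      f ((z.2 : ℝ) • (z.1 : V))) := by fun_prop
  have h2 := h1.lintegral_comp hm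
  have h3 : ∫⁻ v, f v = ∫⁻ v in ({0}ᶜ : Set V), f v := by
    rw [restrict_compl_singleton]
  rw [h3, ← lintegral_subtype_comap (measurableSet_singleton _).compl]
  have h4 : (∫⁻ v : ({0}ᶜ : Set V), f v ∂(Measure.comap Subtype.val volume)) =
      ∫⁻ a : ({0}ᶜ : Set V), f (((homeomorphUnitSphereProd V a).2 : ℝ) •
        ((homeomorphUnitSphereProd V a).1 : V)) ∂(Measure.comap Subtype.val volume) := by
    congr 1
    funext a
    have : (a : V) ≠ 0 := a.2
    congr 1
    simp [smul_smul, this]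
  rw [h4, h2, lintegral_prod _ hm.aemeasurable]
  congr 1
  funext u
  rw [Measure.volumeIoiPow, lintegral_withDensity_eq_lintegral_mul _ (by fun_prop) (by fun_prop)]
  exact lintegral_subtype_comap measurableSet_Ioi
    (fun r : ℝ => ENNReal.ofReal (r ^ (Module.finrank ℝ V - 1)) * f (r • (u : V)))

lemma lintegral_line (g : ℝ → ℝ≥0∞) (hg : Measurable g) (a : ℝ) :
    ∫⁻ r, g r = 2 * ∫⁻ t, g (2 * (t - a)) := by
  have h := Real.smul_map_volume_mul_left (a := 2) (by norm_num)
  conv_lhs => rw [← h]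
  rw [lintegral_smul_measure, lintegral_map hg (by fun_prop)]
  have := lintegral_sub_right_eq_self (μ := (volume : Measure ℝ)) (fun t => g (2 * t)) a
  rw [this]
  simp

lemma line_bound {A C : Set V} (hA : MeasurableSet A) (hC : MeasurableSet C) {R : ℝ}
    (hR : 0 < R) (hAR : A ⊆ Metric.ball 0 R) (hCR : C ⊆ Metric.ball 0 R) {η : ℝ≥0∞}
    {u : V} (hu : ‖u‖ = 1) (h : ∀ t, volume {x | x ∈ A ∧ hrefl u t x ∈ C} ≤ η) :
    ∫⁻ r : ℝ, ∫⁻ x, cnt (x ∈ A) * cnt (x + r • u ∈ C) ≤ 2 * (η * ENNReal.ofReal (2 * R)) := by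
  have mA := measurable_cnt hA
  have mC := measurable_cnt hC
  rw [lintegral_lintegral_swap (by
    apply Measurable.aemeasurable
    exact (mA.comp measurable_snd).mul (mC.comp (by fun_prop)))]
  have h1 : ∀ x, ∫⁻ r : ℝ, cnt (x ∈ A) * cnt (x + r • u ∈ C) =
      ∫⁻ t : ℝ, 2 * (cnt (x ∈ A) * cnt (hrefl u t x ∈ C)) := by
    intro x
    have hm : Measurable (fun r : ℝ => cnt (x ∈ A) * cnt (x + r • u ∈ C)) :=
      measurable_const.mul (mC.comp (by fun_prop))
    rw [lintegral_line _ hm (inner ℝ x u), ← lintegral_const_mul' _ _ (by norm_num)]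
    congr 1
    funext t
    congr 4
    rw [hrefl]
    module
  simp only [h1]
  rw [lintegral_lintegral_swap (by
    apply Measurable.aemeasurable
    exact measurable_const.mul ((mA.comp measurable_fst).mul (mC.comp (by unfold hrefl; fun_prop))))]
  have h2 : ∀ t : ℝ, ∫⁻ x, 2 * (cnt (x ∈ A) * cnt (hrefl u t x ∈ C)) ≤
      (Set.Ioo (-R) R).indicator (fun _ => 2 * η) t := by
    intro t
    have hm : MeasurableSet {x | x ∈ A ∧ hrefl u t x ∈ C} := hA.inter (measurable_hrefl u t hC)
    have e : ∫⁻ x, 2 * (cnt (x ∈ A) * cnt (hrefl u t x ∈ C)) =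
        2 * volume {x | x ∈ A ∧ hrefl u t x ∈ C} := by
      rw [lintegral_const_mul' _ _ (by norm_num), ← lintegral_cnt hm]
      congr 2
      funext x
      by_cases c1 : x ∈ A <;> by_cases c2 : hrefl u t x ∈ C <;> simp [cnt, c1, c2]
    rw [e]
    by_cases ht : t ∈ Set.Ioo (-R) R
    · rw [Set.indicator_of_mem ht]
      gcongr
      exact h t
    · have : {x | x ∈ A ∧ hrefl u t x ∈ C} = ∅ := by
        ext x
        simp only [Set.mem_ofPred_eq, Set.mem_empty_iff_false, iff_false, not_and]
        intro hx hy
        apply ht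
        have hx1 := mem_ball_zero_iff.1 (hAR hx)
        have hy1 := mem_ball_zero_iff.1 (hCR hy)
        have i1 := abs_real_inner_le_norm x u
        have i2 := abs_real_inner_le_norm (hrefl u t x) u
        rw [inner_hrefl hu, hu, mul_one, abs_le] at i2
        rw [hu, mul_one, abs_le] at i1
        constructor <;> linarith [i1.1, i1.2, i2.1, i2.2]
      rw [this]
      simp
  calc _ ≤ ∫⁻ t, (Set.Ioo (-R) R).indicator (fun _ => 2 * η) t := lintegral_mono h2
    _ = _ := by
      rw [lintegral_indicator_const measurableSet_Ioo, Real.volume_Ioo, mul_assoc]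
      congr 3
      ring_nf

lemma average_bound [Nontrivial V] {A C : Set V} (hA : MeasurableSet A) (hC : MeasurableSet C)
    {R : ℝ} (hR : 0 < R) (hAR : A ⊆ Metric.ball 0 R) (hCR : C ⊆ Metric.ball 0 R) {η : ℝ≥0∞}
    (h : ∀ u : V, ‖u‖ = 1 → ∀ t, volume {x | x ∈ A ∧ hrefl u t x ∈ C} ≤ η) :
    volume A * volume C ≤ (ENNReal.ofReal ((2 * R) ^ (Module.finrank ℝ V - 1)) *
      (2 * ENNReal.ofReal (2 * R)) * (volume : Measure V).toSphere Set.univ) * η := by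
  have mA := measurable_cnt hA
  have mC := measurable_cnt hC
  have mAC : Measurable (fun z : V × V => cnt (z.2 ∈ A) * cnt (z.2 + z.1 ∈ C)) :=
    (mA.comp measurable_snd).mul (mC.comp (by fun_prop))
  have h1 : volume A * volume C = ∫⁻ v, ∫⁻ x, cnt (x ∈ A) * cnt (x + v ∈ C) := by
    rw [lintegral_lintegral_swap mAC.aemeasurable]
    have : ∀ x, ∫⁻ v, cnt (x ∈ A) * cnt (x + v ∈ C) = cnt (x ∈ A) * volume C := by
      intro x
      have hm : Measurable (fun v => cnt (x + v ∈ C)) := mC.comp (measurable_const_add x)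
      rw [lintegral_const_mul _ hm,
        lintegral_add_left_eq_self (fun v => cnt (v ∈ C)) x, lintegral_cnt hC]
    simp only [this]
    rw [lintegral_mul_const _ mA, lintegral_cnt hA]
  have mf : Measurable (fun v : V => ∫⁻ x, cnt (x ∈ A) * cnt (x + v ∈ C)) :=
    mAC.lintegral_prod_right'
  rw [h1, lintegral_polar_coord mf]
  set K := ENNReal.ofReal ((2 * R) ^ (Module.finrank ℝ V - 1)) with hK
  calc _ ≤ ∫⁻ u : Metric.sphere (0 : V) 1, K * (2 * (η * ENNReal.ofReal (2 * R)))
        ∂(volume : Measure V).toSphere := by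
        refine lintegral_mono fun u => ?_
        have hu : ‖(u : V)‖ = 1 := by simp
        calc _ ≤ ∫⁻ r in Set.Ioi (0 : ℝ), K * ∫⁻ x, cnt (x ∈ A) * cnt (x + r • (u : V) ∈ C) := by
              refine setLIntegral_mono' measurableSet_Ioi fun r hr => ?_
              have hr' : (0 : ℝ) < r := hr
              by_cases hr2 : r ≤ 2 * R
              · rw [hK]; gcongr
              · have e : ∀ x, cnt (x ∈ A) * cnt (x + r • (u : V) ∈ C) = 0 := by
                  intro x
                  by_cases c1 : x ∈ A
                  · by_cases c2 : x + r • (u : V) ∈ C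
                    · exfalso
                      apply hr2
                      have hx1 := mem_ball_zero_iff.1 (hAR c1)
                      have hy1 := mem_ball_zero_iff.1 (hCR c2)
                      have : ‖r • (u : V)‖ ≤ ‖x + r • (u : V)‖ + ‖x‖ := by
                        have := norm_sub_le (x + r • (u : V)) x
                        simpa using this
                      rw [norm_smul, hu, mul_one, Real.norm_eq_abs, abs_of_pos hr'] at this
                      linarith
                    · simp [cnt, c2]
                  · simp [cnt, c1]
                simp [e]
          _ = K * ∫⁻ r in Set.Ioi (0 : ℝ), ∫⁻ x, cnt (x ∈ A) * cnt (x + r • (u : V) ∈ C) := by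
              rw [lintegral_const_mul' _ _ ENNReal.ofReal_ne_top]
          _ ≤ K * ∫⁻ r : ℝ, ∫⁻ x, cnt (x ∈ A) * cnt (x + r • (u : V) ∈ C) := by
              gcongr
              exact Measure.restrict_le_self
          _ ≤ _ := by
              gcongr
              exact line_bound hA hC hR hAR hCR hu (h u hu)
    _ = _ := by
        rw [lintegral_const]
        ring

end Averaging

section Optimization

set_option linter.unusedSectionVars false

variable {V : Type*} [NormedAddCommGroup V] [InnerProductSpace ℝ V]
variable [FiniteDimensional ℝ V] [MeasurableSpace V] [BorelSpace V]

/-- Admissible sets: better than `E`, and stable under polarization. -/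
def admis (p : ℝ) (E F : Set V) : Prop :=
  MeasurableSet F ∧ volume F = volume E ∧ energy p F ≤ energy p E ∧
    ∀ r : ℝ, volume (E ∩ Metric.ball 0 r) ≤ volume (F ∩ Metric.ball 0 r)

lemma admis_polar {p : ℝ} (hp : 0 ≤ p) {E F : Set V} (h : admis p E F) {u : V} (hu : ‖u‖ = 1)
    {t : ℝ} (ht : 0 ≤ t) : admis p E (polar u t F) := by
  refine ⟨measurableSet_polar u t h.1, (volume_polar hu t h.1).trans h.2.1,
    (energy_polar_le hp hu t h.1).trans h.2.2.1, fun r => (h.2.2.2 r).trans ?_⟩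
  exact le_trans (le_add_of_nonneg_right zero_le) (volume_polar_inter hu ht h.1 r)

lemma exists_tail {E : Set V} (hEf : volume E ≠ ⊤) {d : ℝ} (hd : 0 < d) (ρ : ℝ) :
    ∃ R, ρ ≤ R ∧ 0 < R ∧ volume.real E - d < volume.real (E ∩ Metric.ball 0 R) := by
  have hmono : Monotone (fun n : ℕ => E ∩ Metric.ball (0 : V) n) := by
    intro m n hmn
    exact Set.inter_subset_inter_right _ (Metric.ball_subset_ball (by exact_mod_cast hmn))
  have h1 := tendsto_measure_iUnion_atTop (μ := (volume : Measure V)) hmono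
  rw [← Set.inter_iUnion, Metric.iUnion_ball_nat, Set.inter_univ] at h1
  have h2 := (ENNReal.tendsto_toReal hEf).comp h1
  have h3 := h2.eventually (lt_mem_nhds (show volume.real E - d < (volume E).toReal by
    rw [measureReal_def]; linarith))
  obtain ⟨n, hn, hn2⟩ := (h3.and (Filter.eventually_ge_atTop (⌈ρ⌉₊ + 1))).exists
  refine ⟨n, (Nat.le_ceil ρ).trans (by exact_mod_cast (by omega)), by exact_mod_cast (by omega), hn⟩

lemma exists_close [Nontrivial V] {p : ℝ} (hp : 0 ≤ p) {E : Set V} (hE : MeasurableSet E)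
    {ρ : ℝ} (hEv : volume E = volume (Metric.ball (0 : V) ρ)) {d : ℝ} (hd : 0 < d) :
    ∃ F, admis p E F ∧ volume.real E - d < volume.real (F ∩ Metric.ball 0 ρ) := by
  by_contra hcon
  push Not at hcon
  set B := Metric.ball (0 : V) ρ with hB
  have hBm : MeasurableSet B := Metric.isOpen_ball.measurableSet
  have hBf : volume B ≠ ⊤ := measure_ball_lt_top.ne
  have hEf : volume E ≠ ⊤ := hEv ▸ hBf
  obtain ⟨R, hρR, hR, hRt⟩ := exists_tail hEf (half_pos hd) ρ
  set S := (fun F => volume.real (F ∩ B)) '' {F | admis p E F} with hS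
  have hEad : admis p E E := ⟨hE, rfl, le_rfl, fun _ => le_rfl⟩
  have hSne : S.Nonempty := ⟨_, E, hEad, rfl⟩
  have hSb : BddAbove S := ⟨volume.real E - d, by rintro _ ⟨F, hF, rfl⟩; exact hcon F hF⟩
  set M := sSup S with hM
  set K := (ENNReal.ofReal ((2 * R) ^ (Module.finrank ℝ V - 1)) *
      (2 * ENNReal.ofReal (2 * R)) * (volume : Measure V).toSphere Set.univ) with hK
  have hKf : K ≠ ⊤ := by
    rw [hK]
    finiteness
  have key : ∀ F, admis p E F → d / 2 * d ≤ K.toReal * (M - volume.real (F ∩ B)) := by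
    intro F hF
    have hFm := hF.1
    have hFf : volume F ≠ ⊤ := by rw [hF.2.1]; exact hEf
    have hFM : volume.real (F ∩ B) ≤ M := le_csSup hSb ⟨F, hF, rfl⟩
    set A := (F \ B) ∩ Metric.ball 0 R with hA
    set C := B \ F with hC
    have hAm : MeasurableSet A := (hFm.diff hBm).inter Metric.isOpen_ball.measurableSet
    have hCm : MeasurableSet C := hBm.diff hFm
    have hAv : d / 2 ≤ volume.real A := by
      have e : A = (F ∩ Metric.ball 0 R) \ (F ∩ B) := by
        ext x; simp only [hA, Set.mem_inter_iff, Set.mem_sdiff]; tauto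
      have hsub : F ∩ B ⊆ F ∩ Metric.ball 0 R :=
        Set.inter_subset_inter_right _ (Metric.ball_subset_ball hρR)
      have hfin : volume (F ∩ Metric.ball 0 R) ≠ ⊤ := measure_ne_top_of_subset Set.inter_subset_left hFf
      rw [e, measureReal_sdiff hsub (hFm.inter hBm)]
      have h1 := hcon F hF
      have h2 : volume.real (E ∩ Metric.ball 0 R) ≤ volume.real (F ∩ Metric.ball 0 R) :=
        ENNReal.toReal_mono hfin (hF.2.2.2 R)
      linarith
    have hCv : d ≤ volume.real C := by
      have e : C = B \ (F ∩ B) := by ext x; simp only [hC, Set.mem_inter_iff, Set.mem_sdiff]; tauto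
      rw [e, measureReal_sdiff Set.inter_subset_right (hFm.inter hBm)]
      have h1 := hcon F hF
      have h2 : volume.real E = volume.real B := by rw [measureReal_def, hEv, measureReal_def]
      linarith
    have hη0 : ∀ u : V, ‖u‖ = 1 → ∀ t, 0 ≤ t → volume {x | x ∈ A ∧ hrefl u t x ∈ C} ≤
        ENNReal.ofReal (M - volume.real (F ∩ B)) := by
      intro u hu t ht
      have h1 := volume_polar_inter hu ht hFm ρ
      have had := admis_polar hp hF hu ht
      have h2 : volume.real (polar u t F ∩ B) ≤ M := le_csSup hSb ⟨_, had, rfl⟩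
      have hf1 : volume (polar u t F ∩ B) ≠ ⊤ := measure_ne_top_of_subset Set.inter_subset_right hBf
      have hf2 : volume (F ∩ B) ≠ ⊤ := measure_ne_top_of_subset Set.inter_subset_right hBf
      have h3 : volume {x | x ∈ A ∧ hrefl u t x ∈ C} ≤
          volume {x | x ∈ F \ B ∧ hrefl u t x ∈ B \ F} :=
        measure_mono fun x hx => ⟨hx.1.1, hx.2⟩
      refine h3.trans ?_
      have hf3 : volume {x | x ∈ F \ B ∧ hrefl u t x ∈ B \ F} ≠ ⊤ :=
        ne_top_of_le_ne_top hf1 (le_trans (le_add_of_nonneg_left zero_le) h1)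
      rw [ENNReal.le_ofReal_iff_toReal_le hf3 (by linarith)]
      have h4 := ENNReal.toReal_mono hf1 h1
      rw [ENNReal.toReal_add hf2 hf3] at h4
      simp only [measureReal_def] at *
      linarith
    have hη : ∀ u : V, ‖u‖ = 1 → ∀ t, volume {x | x ∈ A ∧ hrefl u t x ∈ C} ≤
        ENNReal.ofReal (M - volume.real (F ∩ B)) := by
      intro u hu t
      rcases le_total 0 t with ht | ht
      · exact hη0 u hu t ht
      · have := hη0 (-u) (by rwa [norm_neg]) (-t) (by linarith)
        simpa only [hrefl_neg] using this
    have h1 := average_bound hAm hCm hR Set.inter_subset_right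
      (Set.sdiff_subset.trans (Metric.ball_subset_ball hρR)) hη
    have h2 := ENNReal.toReal_mono (ENNReal.mul_ne_top hKf ENNReal.ofReal_ne_top) h1
    rw [ENNReal.toReal_mul, ENNReal.toReal_mul, ENNReal.toReal_ofReal (by linarith)] at h2
    refine le_trans ?_ h2
    exact mul_le_mul hAv hCv hd.le ENNReal.toReal_nonneg
  have hK0 : 0 ≤ K.toReal := ENNReal.toReal_nonneg
  have hε : 0 < d / 2 * d / (2 * (K.toReal + 1)) := by positivity
  obtain ⟨_, ⟨F, hF, rfl⟩, hlt⟩ := exists_lt_of_lt_csSup hSne (show M - d / 2 * d / (2 * (K.toReal + 1)) < M by linarith)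
  have h1 := key F hF
  have h2 : K.toReal * (M - volume.real (F ∩ B)) ≤ (K.toReal + 1) * (d / 2 * d / (2 * (K.toReal + 1))) := by
    have : volume.real (F ∩ B) ≤ M := le_csSup hSb ⟨F, hF, rfl⟩
    simp only at hlt
    apply mul_le_mul <;> linarith
  have h3 : (K.toReal + 1) * (d / 2 * d / (2 * (K.toReal + 1))) = d / 2 * d / 2 := by
    field_simp
  have : 0 < d / 2 * d := by positivity
  linarith

theorem energy_ball_le [Nontrivial V] {p : ℝ} (hp : 0 ≤ p) {E : Set V} (hE : MeasurableSet E)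
    {ρ : ℝ} (hEv : volume E = volume (Metric.ball (0 : V) ρ)) :
    energy p (Metric.ball (0 : V) ρ) ≤ energy p E := by
  set B := Metric.ball (0 : V) ρ with hB
  have hBm : MeasurableSet B := Metric.isOpen_ball.measurableSet
  have hBf : volume B ≠ ⊤ := measure_ball_lt_top.ne
  choose F hF hFd using fun n : ℕ =>
    exists_close hp hE hEv (d := (1 / 2 : ℝ) ^ n) (by positivity)
  have hFf : ∀ n, volume (F n) ≠ ⊤ := fun n => by rw [(hF n).2.1, hEv]; exact hBf
  have hv : volume.real E = volume.real B := by rw [measureReal_def, hEv, measureReal_def]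
  have hbound : ∀ n, volume (symmDiff (F n) B) ≤ ENNReal.ofReal (2 * (1 / 2 : ℝ) ^ n) := by
    intro n
    have hFv : volume.real (F n) = volume.real E := by
      rw [measureReal_def, (hF n).2.1, measureReal_def]
    have hd := hFd n
    have e1 : volume.real (F n \ B) ≤ (1 / 2 : ℝ) ^ n := by
      have := measureReal_inter_add_sdiff (μ := (volume : Measure V)) (s := F n) hBm (hFf n)
      linarith
    have e2 : volume.real (B \ F n) ≤ (1 / 2 : ℝ) ^ n := by
      have := measureReal_inter_add_sdiff (μ := (volume : Measure V)) (s := B) (hF n).1 hBf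
      rw [Set.inter_comm] at this
      linarith
    have f1 : volume (F n \ B) ≠ ⊤ := measure_ne_top_of_subset Set.sdiff_subset (hFf n)
    have f2 : volume (B \ F n) ≠ ⊤ := measure_ne_top_of_subset Set.sdiff_subset hBf
    have : (0 : ℝ) ≤ (1 / 2 : ℝ) ^ n := by positivity
    calc volume (symmDiff (F n) B) ≤ volume (F n \ B) + volume (B \ F n) := measure_union_le _ _
      _ ≤ ENNReal.ofReal ((1 / 2 : ℝ) ^ n) + ENNReal.ofReal ((1 / 2 : ℝ) ^ n) := by
          gcongr
          · exact (ENNReal.le_ofReal_iff_toReal_le f1 this).2 e1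
          · exact (ENNReal.le_ofReal_iff_toReal_le f2 this).2 e2
      _ = _ := by rw [← ENNReal.ofReal_add this this]; ring_nf
  have hsum : ∑' n, volume (symmDiff (F n) B) ≠ ⊤ := by
    refine ne_top_of_le_ne_top ?_ (ENNReal.tsum_le_tsum hbound)
    rw [← ENNReal.ofReal_tsum_of_nonneg (fun n => by positivity)
      (Summable.mul_left _ (summable_geometric_of_lt_one (by norm_num) (by norm_num)))]
    exact ENNReal.ofReal_ne_top
  have hae : ∀ᵐ x : V, ∀ᶠ n in Filter.atTop, (x ∈ F n ↔ x ∈ B) := by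
    filter_upwards [ae_eventually_notMem hsum] with x hx
    filter_upwards [hx] with n hn
    rw [Set.mem_symmDiff] at hn
    tauto
  have hm : ∀ n, Measurable (fun z : V × V => kern p z.1 z.2 * dis (F n) z.1 z.2) := fun n =>
    (measurable_kern p).mul (measurable_dis (hF n).1)
  have hae2 : ∀ᵐ z : V × V ∂(volume.prod volume), kern p z.1 z.2 * dis B z.1 z.2 ≤
      Filter.liminf (fun n => kern p z.1 z.2 * dis (F n) z.1 z.2) Filter.atTop := by
    have g1 := Measure.quasiMeasurePreserving_fst (μ := (volume : Measure V))
      (ν := (volume : Measure V)) |>.ae hae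
    have g2 := Measure.quasiMeasurePreserving_snd (μ := (volume : Measure V))
      (ν := (volume : Measure V)) |>.ae hae
    filter_upwards [g1, g2] with z h1 h2
    refine Filter.le_liminf_of_le (by isBoundedDefault) ?_
    filter_upwards [h1, h2] with n h3 h4
    have e : dis B z.1 z.2 = dis (F n) z.1 z.2 := by
      change pd _ _ = pd _ _
      rw [h3, h4]
    rw [e]
  calc energy p B ≤ ∫⁻ z : V × V, Filter.liminf (fun n => kern p z.1 z.2 * dis (F n) z.1 z.2)
        Filter.atTop ∂(volume.prod volume) := lintegral_mono_ae hae2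
    _ ≤ Filter.liminf (fun n => energy p (F n)) Filter.atTop := lintegral_liminf_le hm
    _ ≤ energy p E := by
      refine Filter.liminf_le_of_le (by isBoundedDefault) ?_
      intro b hb
      obtain ⟨n, hn⟩ := hb.exists
      exact hn.trans (hF n).2.2.1

end Optimization

section GaussianMoment

lemma integral_abs_rpow_gauss {s : ℝ} (hs' : s < 1 / 2) :
    ∫ t : ℝ, |t| ^ (-(2 * s)) * exp (-t ^ 2) = Gamma (1 / 2 - s) := by
  have h := integral_comp_abs (f := fun t => t ^ (-(2 * s)) * exp (-t ^ 2))
  simp only [sq_abs] at h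
  rw [h]
  have h2 := integral_rpow_mul_exp_neg_rpow (p := 2) (q := -(2 * s)) (by norm_num) (by linarith)
  simp only [Real.rpow_two] at h2
  rw [h2]
  ring_nf

lemma integral_gauss_one : ∫ t : ℝ, exp (-t ^ 2) = √π := by
  have := integral_gaussian 1
  simpa using this

lemma lintegral_pi_gauss {N : ℕ} (i₀ : Fin N) {s : ℝ} (hs' : s < 1 / 2) :
    ∫⁻ x : Fin N → ℝ, ENNReal.ofReal (|x i₀| ^ (-(2 * s)) * exp (-∑ i, x i ^ 2)) =
      ENNReal.ofReal (Gamma (1 / 2 - s) * √π ^ (N - 1)) := by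
  have hG : 0 < Gamma (1 / 2 - s) := Gamma_pos_of_pos (by linarith)
  set f : Fin N → ℝ → ℝ := fun i t =>
    if i = i₀ then |t| ^ (-(2 * s)) * exp (-t ^ 2) else exp (-t ^ 2) with hf
  have e : ∀ x : Fin N → ℝ, |x i₀| ^ (-(2 * s)) * exp (-∑ i, x i ^ 2) = ∏ i, f i (x i) := by
    intro x
    rw [← Finset.sum_neg_distrib, Real.exp_sum, ← Finset.mul_prod_erase _ _ (Finset.mem_univ i₀),
      ← Finset.mul_prod_erase _ (fun i => f i (x i)) (Finset.mem_univ i₀), ← mul_assoc]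
    congr 1
    · simp [hf]
    · refine Finset.prod_congr rfl fun i hi => ?_
      simp [hf, Finset.ne_of_mem_erase hi]
  have h1 := integral_fintype_prod_volume_eq_prod f
  have h2 : ∏ i, ∫ t, f i t = Gamma (1 / 2 - s) * √π ^ (N - 1) := by
    rw [← Finset.mul_prod_erase _ _ (Finset.mem_univ i₀)]
    congr 1
    · simp only [hf, if_true]
      exact integral_abs_rpow_gauss hs'
    · rw [Finset.prod_congr rfl (g := fun _ => √π)]
      · simp
      · intro i hi
        simp only [hf, Finset.ne_of_mem_erase hi, if_false]
        exact integral_gauss_one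
  simp only [e]
  rw [← ofReal_integral_eq_lintegral_ofReal, h1, h2]
  · apply Integrable.of_integral_ne_zero
    rw [h1, h2]
    positivity
  · refine Filter.Eventually.of_forall fun x => Finset.prod_nonneg fun i _ => ?_
    simp only [hf]
    split_ifs <;> positivity

lemma lintegral_gauss {N : ℕ} (hN : 0 < N) {s : ℝ} (hs' : s < 1 / 2)
    {u : EuclideanSpace ℝ (Fin N)} (hu : ‖u‖ = 1) :
    ∫⁻ x : EuclideanSpace ℝ (Fin N),
      ENNReal.ofReal (|inner ℝ x u| ^ (-(2 * s)) * exp (-‖x‖ ^ 2)) =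
      ENNReal.ofReal (Gamma (1 / 2 - s) * √π ^ (N - 1)) := by
  set i₀ : Fin N := ⟨0, hN⟩
  obtain ⟨b, hb⟩ := Orthonormal.exists_orthonormalBasis_extension_of_card_eq (𝕜 := ℝ)
    (E := EuclideanSpace ℝ (Fin N)) (ι := Fin N) (by simp) (v := fun _ => u) (s := {i₀})
    (by
      rw [orthonormal_iff_ite]
      rintro ⟨i, hi⟩ ⟨j, hj⟩
      have : i = j := by rw [hi, hj]
      simp [this, Set.domRestrict, hu])
  have hb0 : b i₀ = u := hb i₀ rfl
  rw [← lintegral_pi_gauss i₀ hs', ← (PiLp.volume_preserving_ofLp (Fin N)).lintegral_comp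
    (by fun_prop)]
  refine Eq.trans ?_ (b.measurePreserving_repr.lintegral_comp
    (f := fun y : EuclideanSpace ℝ (Fin N) =>
      ENNReal.ofReal (|y i₀| ^ (-(2 * s)) * exp (-∑ i, y i ^ 2))) (by fun_prop))
  congr 1
  funext x
  have e1 : inner ℝ x u = (b.repr x) i₀ := by
    rw [b.repr_apply_apply, hb0, real_inner_comm]
  have e2 : ‖x‖ ^ 2 = ∑ i, (b.repr x) i ^ 2 := by
    rw [← b.repr.norm_map x, EuclideanSpace.norm_sq_eq]
    simp
  rw [e1, e2]

end GaussianMoment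

section BallMoment

set_option linter.unusedSectionVars false

variable {V : Type*} [NormedAddCommGroup V] [InnerProductSpace ℝ V]
variable [FiniteDimensional ℝ V] [MeasurableSpace V] [BorelSpace V]

/-- Moment of the ball. -/
noncomputable def bmom (s : ℝ) (u : V) (ρ : ℝ) : ℝ≥0∞ :=
  ∫⁻ x in Metric.ball (0 : V) ρ, ENNReal.ofReal (|inner ℝ x u| ^ (-(2 * s)))

lemma lintegral_scale {f : V → ℝ≥0∞} (hf : Measurable f) {ρ : ℝ} (hρ : 0 < ρ) :
    ∫⁻ x, f x = ENNReal.ofReal (ρ ^ Module.finrank ℝ V) * ∫⁻ x, f (ρ • x) := by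
  have h := Measure.map_addHaar_smul (volume : Measure V) hρ.ne'
  have h2 : ∫⁻ x, f (ρ • x) = ∫⁻ x, f x ∂(Measure.map (fun x => ρ • x) volume) := by
    rw [lintegral_map hf (by fun_prop)]
  have h3 : Measure.map (fun x => ρ • x) (volume : Measure V) =
    ENNReal.ofReal |(ρ ^ Module.finrank ℝ V)⁻¹| • volume := h
  rw [h2, h3, lintegral_smul_measure, smul_eq_mul, ← mul_assoc, ← ENNReal.ofReal_mul (by positivity),
    abs_of_pos (by positivity), mul_inv_cancel₀ (by positivity), ENNReal.ofReal_one, one_mul]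

lemma bmom_scale (s : ℝ) (u : V) {ρ : ℝ} (hρ : 0 < ρ) :
    bmom s u ρ = ENNReal.ofReal (ρ ^ ((Module.finrank ℝ V : ℝ) - 2 * s)) * bmom s u 1 := by
  unfold bmom
  rw [← lintegral_indicator Metric.isOpen_ball.measurableSet,
    ← lintegral_indicator Metric.isOpen_ball.measurableSet,
    lintegral_scale (Measurable.indicator (by fun_prop) Metric.isOpen_ball.measurableSet) hρ,
    ← lintegral_const_mul' _ _ ENNReal.ofReal_ne_top,
    ← lintegral_const_mul' _ _ ENNReal.ofReal_ne_top]
  congr 1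
  funext x
  have hm : ρ • x ∈ Metric.ball (0 : V) ρ ↔ x ∈ Metric.ball (0 : V) 1 := by
    simp only [mem_ball_zero_iff, norm_smul, Real.norm_eq_abs, abs_of_pos hρ]
    constructor
    · intro h; nlinarith
    · intro h; nlinarith
  by_cases hx : x ∈ Metric.ball (0 : V) 1
  · rw [Set.indicator_of_mem hx, Set.indicator_of_mem (hm.2 hx), ← ENNReal.ofReal_mul (by positivity),
      ← ENNReal.ofReal_mul (by positivity), real_inner_smul_left, abs_mul, abs_of_pos hρ,
      Real.mul_rpow hρ.le (abs_nonneg _), sub_eq_add_neg, Real.rpow_add hρ, Real.rpow_natCast]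
    congr 1
    ring
  · rw [Set.indicator_of_notMem hx, Set.indicator_of_notMem (fun h => hx (hm.1 h))]
    simp

lemma lintegral_tail_gauss (a : ℝ) (ha : 0 ≤ a) :
    ∫⁻ τ in Set.Ioi a, ENNReal.ofReal (2 * τ * exp (-τ ^ 2)) = ENNReal.ofReal (exp (-a ^ 2)) := by
  have hd : ∀ τ ∈ Set.Ici a, HasDerivAt (fun τ : ℝ => -exp (-τ ^ 2)) (2 * τ * exp (-τ ^ 2)) τ := by
    intro τ _
    have := (((hasDerivAt_id τ).pow 2).neg.exp).neg
    convert! this using 1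
    simp
    ring
  have hlim : Filter.Tendsto (fun τ : ℝ => -exp (-τ ^ 2)) Filter.atTop (nhds 0) := by
    have : Filter.Tendsto (fun τ : ℝ => exp (-τ ^ 2)) Filter.atTop (nhds 0) :=
      Real.tendsto_exp_neg_atTop_nhds_zero.comp (Filter.tendsto_pow_atTop (by norm_num))
    simpa using this.neg
  have hnn : ∀ τ ∈ Set.Ioi a, 0 ≤ 2 * τ * exp (-τ ^ 2) := by
    intro τ hτ
    have : 0 ≤ τ := ha.trans (le_of_lt hτ)
    positivity
  have hIntg := integrableOn_Ioi_deriv_of_nonneg' hd hnn hlim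
  rw [← ofReal_integral_eq_lintegral_ofReal hIntg
    ((ae_restrict_iff' measurableSet_Ioi).2 (Filter.Eventually.of_forall hnn)),
    integral_Ioi_of_hasDerivAt_of_nonneg' hd hnn hlim]
  simp

lemma bmom_gamma {s : ℝ} (hs' : s < 1 / 2) [Nontrivial V] (u : V) :
    ∫⁻ x : V, ENNReal.ofReal (|inner ℝ x u| ^ (-(2 * s)) * exp (-‖x‖ ^ 2)) =
      ENNReal.ofReal (Gamma ((Module.finrank ℝ V : ℝ) / 2 + 1 - s)) * bmom s u 1 := by
  have hn : (1 : ℝ) ≤ Module.finrank ℝ V := by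
    exact_mod_cast Module.finrank_pos (R := ℝ) (M := V)
  set n : ℝ := (Module.finrank ℝ V : ℝ) with hn'
  have h1 : ∀ x : V, ENNReal.ofReal (|inner ℝ x u| ^ (-(2 * s)) * exp (-‖x‖ ^ 2)) =
      ∫⁻ τ in Set.Ioi (0 : ℝ), (ENNReal.ofReal (2 * τ * exp (-τ ^ 2))) *
        (Metric.ball (0 : V) τ).indicator (fun x => ENNReal.ofReal (|inner ℝ x u| ^ (-(2 * s)))) x := by
    intro x
    have e : ∀ τ : ℝ, (Set.Ioi (0 : ℝ)).indicator (fun τ => (ENNReal.ofReal (2 * τ * exp (-τ ^ 2))) *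
        (Metric.ball (0 : V) τ).indicator (fun x => ENNReal.ofReal (|inner ℝ x u| ^ (-(2 * s)))) x) τ =
        (Set.Ioi ‖x‖).indicator (fun τ => ENNReal.ofReal (|inner ℝ x u| ^ (-(2 * s))) *
          ENNReal.ofReal (2 * τ * exp (-τ ^ 2))) τ := by
      intro τ
      by_cases h : ‖x‖ < τ
      · have h0 : τ ∈ Set.Ioi (0 : ℝ) := lt_of_le_of_lt (norm_nonneg _) h
        rw [Set.indicator_of_mem h0, Set.indicator_of_mem (show τ ∈ Set.Ioi ‖x‖ from h),
          Set.indicator_of_mem (by simpa using h), mul_comm]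
      · rw [Set.indicator_of_notMem (show τ ∉ Set.Ioi ‖x‖ from h)]
        refine Set.indicator_apply_eq_zero.2 fun _ => ?_
        rw [Set.indicator_of_notMem (by simpa using h), mul_zero]
    rw [← lintegral_indicator measurableSet_Ioi, lintegral_congr e,
      lintegral_indicator measurableSet_Ioi, lintegral_const_mul' _ _ ENNReal.ofReal_ne_top,
      lintegral_tail_gauss _ (norm_nonneg _), ENNReal.ofReal_mul (by positivity)]
  rw [lintegral_congr h1, lintegral_lintegral_swap]
  swap
  · apply Measurable.aemeasurable
    refine Measurable.mul (by fun_prop) ?_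
    have : MeasurableSet {z : V × ℝ | ‖z.1‖ < z.2} := measurableSet_lt (by fun_prop) (by fun_prop)
    have hm : Measurable ({z : V × ℝ | ‖z.1‖ < z.2}.indicator
      (fun z => ENNReal.ofReal (|inner ℝ z.1 u| ^ (-(2 * s))))) :=
      Measurable.indicator (by fun_prop) this
    convert! hm using 1
    ext z
    simp [Set.indicator]
  have h2 : ∀ τ ∈ Set.Ioi (0 : ℝ), ∫⁻ x : V, (ENNReal.ofReal (2 * τ * exp (-τ ^ 2))) *
        (Metric.ball (0 : V) τ).indicator (fun x => ENNReal.ofReal (|inner ℝ x u| ^ (-(2 * s)))) x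
      = ENNReal.ofReal (2 * (τ ^ (n + 1 - 2 * s) * exp (-τ ^ 2))) * bmom s u 1 := by
    intro τ hτ
    have hτ' : (0 : ℝ) < τ := hτ
    rw [lintegral_const_mul' _ _ ENNReal.ofReal_ne_top,
      lintegral_indicator Metric.isOpen_ball.measurableSet]
    change _ * bmom s u τ = _
    rw [bmom_scale s u hτ', ← mul_assoc, ← ENNReal.ofReal_mul (by positivity)]
    congr 2
    rw [show n + 1 - 2 * s = 1 + (n - 2 * s) by ring, Real.rpow_add hτ', Real.rpow_one]
    ring
  rw [setLIntegral_congr_fun measurableSet_Ioi h2, lintegral_mul_const _ (by fun_prop)]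
  congr 1
  have h3 := integral_rpow_mul_exp_neg_rpow (p := 2) (q := n + 1 - 2 * s) (by norm_num) (by linarith)
  have h4 := integrableOn_rpow_mul_exp_neg_rpow (p := 2) (s := n + 1 - 2 * s) (by linarith) (by norm_num)
  simp only [Real.rpow_two] at h3 h4
  rw [← ofReal_integral_eq_lintegral_ofReal (h4.const_mul 2), integral_const_mul, h3]
  · congr 1
    rw [← mul_assoc]
    norm_num
    congr 1
    ring
  · refine (ae_restrict_iff' measurableSet_Ioi).2 (Filter.Eventually.of_forall fun τ hτ => ?_)
    have hτ' : (0 : ℝ) < τ := hτ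
    simp only [Pi.zero_apply]
    positivity

lemma bmom_eq {N : ℕ} (hN : 0 < N) {s : ℝ} (hs' : s < 1 / 2)
    {u : EuclideanSpace ℝ (Fin N)} (hu : ‖u‖ = 1) {ρ : ℝ} (hρ : 0 < ρ) :
    bmom s u ρ = ENNReal.ofReal (ρ ^ ((N : ℝ) - 2 * s) *
      (Gamma (1 / 2 - s) * √π ^ (N - 1) / Gamma ((N : ℝ) / 2 + 1 - s))) := by
  have : Nonempty (Fin N) := ⟨⟨0, hN⟩⟩
  have hN' : (1 : ℝ) ≤ N := by exact_mod_cast hN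
  have hG : 0 < Gamma ((N : ℝ) / 2 + 1 - s) := Gamma_pos_of_pos (by linarith)
  have h1 := bmom_gamma hs' u
  rw [lintegral_gauss hN hs' hu, finrank_euclideanSpace_fin] at h1
  rw [bmom_scale s u hρ, finrank_euclideanSpace_fin, ENNReal.ofReal_mul (by positivity)]
  congr 1
  rw [ENNReal.ofReal_div_of_pos hG, h1, mul_comm, ENNReal.mul_div_cancel_right]
  · simpa using hG
  · exact ENNReal.ofReal_ne_top

end BallMoment

section BallEnergy

set_option linter.unusedSectionVars false

variable {V : Type*} [NormedAddCommGroup V] [InnerProductSpace ℝ V]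
variable [FiniteDimensional ℝ V] [MeasurableSpace V] [BorelSpace V]

lemma measurable_cnt_gen {A : Type*} [MeasurableSpace A] {G : Set A} (hG : MeasurableSet G) :
    Measurable (fun x => cnt (x ∈ G)) := by
  unfold cnt
  exact Measurable.ite hG measurable_const measurable_const

lemma slab_le {B : Set V} (hB : MeasurableSet B) (hBv : volume B ≠ ⊤) (h : V) :
    volume {x | x ∈ B ∧ |2 * inner ℝ x h| < ‖h‖ ^ 2} ≤ volume {x | x ∈ B ∧ x + h ∉ B} := by
  by_cases h0 : h = 0
  · subst h0
    simp
  have hq : 0 < ‖h‖ ^ 2 := by positivity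
  have mi : Measurable fun x : V => 2 * inner ℝ x h := by fun_prop
  set C1 : Set V := {x | x ∈ B ∧ 2 * inner ℝ x h ≤ -‖h‖ ^ 2} with hC1
  set C2 : Set V := {x | x ∈ B ∧ ‖h‖ ^ 2 ≤ 2 * inner ℝ x h} with hC2
  set T : Set V := {x | x ∈ B ∧ |2 * inner ℝ x h| < ‖h‖ ^ 2} with hT
  set D : Set V := {x | x ∈ B ∧ x + h ∉ B} with hD
  have mC1 : MeasurableSet C1 := hB.inter (measurableSet_le mi measurable_const)
  have mC2 : MeasurableSet C2 := hB.inter (measurableSet_le measurable_const mi)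
  have f1 : volume C1 ≠ ⊤ := measure_ne_top_of_subset (fun x hx => hx.1) hBv
  have f2 : volume C2 ≠ ⊤ := measure_ne_top_of_subset (fun x hx => hx.1) hBv
  have d1 : Disjoint T C1 := by
    rw [Set.disjoint_left]
    rintro x ⟨_, h1⟩ ⟨_, h2⟩
    linarith [(abs_lt.1 h1).1]
  have d2 : Disjoint (T ∪ C1) C2 := by
    rw [Set.disjoint_left]
    rintro x (⟨_, h1⟩ | ⟨_, h1⟩) ⟨_, h2⟩
    · linarith [(abs_lt.1 h1).2]
    · linarith
  have e1 : volume T + volume C1 + volume C2 ≤ volume B := by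
    rw [← measure_union d1 mC1, ← measure_union d2 mC2]
    refine measure_mono ?_
    rintro x ((h1 | h1) | h1) <;> exact h1.1
  have e2 : volume B ≤ volume D + volume C1 + volume C2 := by
    have e3 : volume ((fun x => x + h) ⁻¹' C2) = volume C2 := measure_preimage_add_right _ _ _
    rw [← e3]
    refine le_trans (measure_mono ?_) ((measure_union_le (D ∪ C1) _).trans
      (add_le_add_left (measure_union_le D C1) _))
    intro x hx
    by_cases c1 : x + h ∈ B
    · by_cases c2 : 2 * inner ℝ x h ≤ -‖h‖ ^ 2
      · exact Or.inl (Or.inr ⟨hx, c2⟩)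
      · refine Or.inr ⟨c1, ?_⟩
        push Not at c2
        rw [inner_add_left, real_inner_self_eq_norm_sq]
        linarith
    · exact Or.inl (Or.inl ⟨hx, c1⟩)
  have e4 := e1.trans e2
  exact (ENNReal.add_le_add_iff_right f1).1 ((ENNReal.add_le_add_iff_right f2).1 e4)

lemma energy_shift (p : ℝ) {B : Set V} (hB : MeasurableSet B) :
    energy p B = ∫⁻ h : V, ∫⁻ x : V, (ENNReal.ofReal ‖h‖) ^ (-p) * dis B x (x + h) := by
  unfold energy
  have hm : Measurable fun z : V × V => kern p z.1 z.2 * dis B z.1 z.2 :=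
    (measurable_kern p).mul (measurable_dis hB)
  rw [lintegral_prod _ hm.aemeasurable]
  have h1 : ∀ x : V, ∫⁻ y, kern p x y * dis B x y =
      ∫⁻ h, (ENNReal.ofReal ‖h‖) ^ (-p) * dis B x (x + h) := by
    intro x
    rw [← lintegral_add_left_eq_self (μ := volume) (fun y => kern p x y * dis B x y) x]
    refine lintegral_congr fun h => ?_
    simp only [kern]
    rw [show x - (x + h) = -h by abel, norm_neg]
  simp only [h1]
  refine lintegral_lintegral_swap (Measurable.aemeasurable ?_)
  refine Measurable.mul (by fun_prop) ?_
  exact (measurable_dis hB).comp (g := fun z : V × V => dis B z.1 z.2)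
    (f := fun z : V × V => (z.1, z.1 + z.2)) (by fun_prop)

lemma shift_ge (p : ℝ) {B : Set V} (hB : MeasurableSet B) (hBv : volume B ≠ ⊤) (h : V) :
    2 * ((ENNReal.ofReal ‖h‖) ^ (-p) * volume {x | x ∈ B ∧ |2 * inner ℝ x h| < ‖h‖ ^ 2}) ≤
      ∫⁻ x : V, (ENNReal.ofReal ‖h‖) ^ (-p) * dis B x (x + h) := by
  have md : Measurable fun x => dis B x (x + h) :=
    (measurable_dis hB).comp (g := fun z : V × V => dis B z.1 z.2)
      (f := fun x : V => (x, x + h)) (by fun_prop)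
  rw [lintegral_const_mul _ md, ← mul_assoc, mul_comm 2, mul_assoc]
  gcongr
  set D : Set V := {x | x ∈ B ∧ x + h ∉ B} with hD
  set D' : Set V := {x | x ∈ B ∧ x + -h ∉ B} with hD'
  have mD : MeasurableSet D := hB.inter ((measurable_add_const h) hB).compl
  have mD' : MeasurableSet D' := hB.inter ((measurable_add_const (-h)) hB).compl
  have a1 := slab_le hB hBv h
  have a2 := slab_le hB hBv (-h)
  simp only [inner_neg_right, mul_neg, abs_neg, norm_neg] at a2
  have e3 : volume ((fun x => x + h) ⁻¹' D') = volume D' := measure_preimage_add_right _ _ _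
  have mD'' : MeasurableSet ((fun x => x + h) ⁻¹' D') := (measurable_add_const h) mD'
  calc 2 * volume {x | x ∈ B ∧ |2 * inner ℝ x h| < ‖h‖ ^ 2}
      ≤ volume D + volume D' := by
        rw [two_mul]; exact add_le_add a1 a2
    _ = ∫⁻ x, (cnt (x ∈ D) + cnt (x ∈ (fun x => x + h) ⁻¹' D')) := by
        rw [lintegral_add_left (measurable_cnt mD), lintegral_cnt mD, lintegral_cnt mD'', e3]
    _ ≤ ∫⁻ x, dis B x (x + h) := by
        refine lintegral_mono fun x => ?_
        have q1 : x ∈ D ↔ (x ∈ B ∧ x + h ∉ B) := Iff.rfl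
        have q2 : x ∈ (fun x => x + h) ⁻¹' D' ↔ (x + h ∈ B ∧ x ∉ B) := by
          rw [Set.mem_preimage, hD', Set.mem_ofPred_eq, add_neg_cancel_right]
        rw [propext q1, propext q2]
        simp only [dis, cnt]
        by_cases c1 : x ∈ B <;> by_cases c2 : x + h ∈ B <;> simp [c1, c2]

lemma radial_ge {s a : ℝ} (hs : 0 < s) (ha : 0 ≤ a) {n : ℕ} (hn : 0 < n) :
    ENNReal.ofReal (a ^ (-(2 * s)) * (1 / (2 * s))) ≤
      ∫⁻ r in Set.Ioi (0 : ℝ), ENNReal.ofReal (r ^ (n - 1)) *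
        ((ENNReal.ofReal r) ^ (-((n : ℝ) + 2 * s)) * cnt (a < r)) := by
  rcases ha.eq_or_lt with rfl | ha
  · rw [Real.zero_rpow (by linarith)]
    simp
  have h1 := integral_Ioi_rpow_of_lt (a := -1 - 2 * s) (by linarith) ha
  have h2 := integrableOn_Ioi_rpow_of_lt (a := -1 - 2 * s) (by linarith) ha
  have h3 : a ^ (-(2 * s)) * (1 / (2 * s)) = ∫ t in Set.Ioi a, t ^ (-1 - 2 * s) := by
    rw [h1]
    rw [show -1 - 2 * s + 1 = -(2 * s) by ring]
    field_simp
  rw [h3, ofReal_integral_eq_lintegral_ofReal h2]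
  · calc ∫⁻ t in Set.Ioi a, ENNReal.ofReal (t ^ (-1 - 2 * s))
        ≤ ∫⁻ r in Set.Ioi a, ENNReal.ofReal (r ^ (n - 1)) *
          ((ENNReal.ofReal r) ^ (-((n : ℝ) + 2 * s)) * cnt (a < r)) := by
          refine setLIntegral_mono' measurableSet_Ioi fun r hr => ?_
          have hr0 : 0 < r := ha.trans hr
          have hr' : a < r := hr
          rw [ENNReal.ofReal_rpow_of_pos hr0]
          simp only [cnt, hr', if_true, mul_one]
          rw [← ENNReal.ofReal_mul (by positivity), ← Real.rpow_natCast, ← Real.rpow_add hr0,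
            Nat.cast_sub hn]
          apply le_of_eq
          congr 2
          push_cast
          ring
      _ ≤ _ := lintegral_mono_set (Set.Ioi_subset_Ioi ha.le)
  · refine (ae_restrict_iff' measurableSet_Ioi).2 (Filter.Eventually.of_forall fun r hr => ?_)
    have hr0 : 0 < r := ha.trans hr
    simp only [Pi.zero_apply]
    positivity

lemma energy_ge [Nontrivial V] {s : ℝ} (hs : 0 < s) {B : Set V} (hB : MeasurableSet B)
    (hBv : volume B ≠ ⊤) :
    ENNReal.ofReal (2 ^ (-(2 * s)) / s) * (∫⁻ u : Metric.sphere (0 : V) 1,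
      (∫⁻ x in B, ENNReal.ofReal (|inner ℝ x (u : V)| ^ (-(2 * s))))
        ∂(volume : Measure V).toSphere) ≤ energy ((Module.finrank ℝ V : ℝ) + 2 * s) B := by
  set n := Module.finrank ℝ V with hn
  have hn0 : 0 < n := Module.finrank_pos
  set p : ℝ := (n : ℝ) + 2 * s with hp
  set S : Set (V × V) := {z | z.2 ∈ B ∧ |2 * inner ℝ z.2 z.1| < ‖z.1‖ ^ 2} with hS
  have mS : MeasurableSet S :=
    (measurable_snd hB).inter (measurableSet_lt (f := fun z : V × V => |2 * inner ℝ z.2 z.1|)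
      (g := fun z : V × V => ‖z.1‖ ^ 2) (by fun_prop) (by fun_prop))
  set F : V → V → ℝ≥0∞ := fun h x => (ENNReal.ofReal ‖h‖) ^ (-p) * cnt ((h, x) ∈ S) with hF
  have mF : Measurable (Function.uncurry F) :=
    Measurable.mul (by fun_prop) (measurable_cnt_gen mS)
  have step1 : 2 * ∫⁻ h, ∫⁻ x, F h x ≤ energy p B := by
    rw [energy_shift p hB, ← lintegral_const_mul' _ _ (by norm_num)]
    refine lintegral_mono fun h => ?_
    refine le_trans (le_of_eq ?_) (shift_ge p hB hBv h)
    have mSh : MeasurableSet {x | x ∈ B ∧ |2 * inner ℝ x h| < ‖h‖ ^ 2} :=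
      (measurable_prodMk_left (x := h)) mS
    rw [← lintegral_cnt mSh, ← lintegral_const_mul _ (measurable_cnt mSh)]
    rfl
  refine le_trans ?_ step1
  rw [lintegral_lintegral_swap mF.aemeasurable]
  have mI : Measurable (fun z : Metric.sphere (0 : V) 1 × V =>
      ENNReal.ofReal (|inner ℝ z.2 (z.1 : V)| ^ (-(2 * s)))) := by fun_prop
  have step2 : ∀ x, (∫⁻ u : Metric.sphere (0 : V) 1, ENNReal.ofReal (2 ^ (-(2 * s)) / (2 * s)) *
      (B.indicator (fun x => ENNReal.ofReal (|inner ℝ x (u : V)| ^ (-(2 * s)))) x)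
        ∂(volume : Measure V).toSphere) ≤ ∫⁻ h, F h x := by
    intro x
    have mFx : Measurable fun h => F h x := mF.comp (measurable_prodMk_right (y := x))
    rw [lintegral_polar_coord mFx]
    refine lintegral_mono fun u => ?_
    by_cases hx : x ∈ B
    · rw [Set.indicator_of_mem hx, ← ENNReal.ofReal_mul (by positivity)]
      refine le_trans (le_of_eq ?_) ((radial_ge (a := 2 * |inner ℝ x (u : V)|) hs (by positivity)
        hn0).trans (le_of_eq ?_))
      · congr 1
        rw [Real.mul_rpow (by norm_num) (abs_nonneg _)]
        ring
      · refine setLIntegral_congr_fun measurableSet_Ioi fun r hr => ?_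
        have hr0 : 0 < r := hr
        have hu : ‖(u : V)‖ = 1 := by simp
        simp only [hF, hS, Set.mem_ofPred_eq, hx, true_and, norm_smul, hu, mul_one,
          Real.norm_eq_abs, abs_of_pos hr0, inner_smul_right, abs_mul, abs_two]
        congr 3
        apply propext
        rw [show 2 * (r * |inner ℝ x (u : V)|) = r * (2 * |inner ℝ x (u : V)|) by ring, sq,
          mul_lt_mul_iff_right₀ hr0]
    · rw [Set.indicator_of_notMem hx, mul_zero]
      exact zero_le
  calc _ = 2 * ∫⁻ x, (∫⁻ u : Metric.sphere (0 : V) 1, ENNReal.ofReal (2 ^ (-(2 * s)) / (2 * s)) *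
      (B.indicator (fun x => ENNReal.ofReal (|inner ℝ x (u : V)| ^ (-(2 * s)))) x)
        ∂(volume : Measure V).toSphere) := by
        have mJ : Measurable (fun z : V × Metric.sphere (0 : V) 1 =>
            (B.indicator (fun x => ENNReal.ofReal (|inner ℝ x (z.2 : V)| ^ (-(2 * s)))) z.1)) := by
          have : (fun z : V × Metric.sphere (0 : V) 1 =>
            (B.indicator (fun x => ENNReal.ofReal (|inner ℝ x (z.2 : V)| ^ (-(2 * s)))) z.1)) =
            (Prod.fst ⁻¹' B).indicator (fun z : V × Metric.sphere (0 : V) 1 =>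
              ENNReal.ofReal (|inner ℝ z.1 (z.2 : V)| ^ (-(2 * s)))) := by
            funext z
            rfl
          rw [this]
          exact Measurable.indicator (by fun_prop) (measurable_fst hB)
        have hsw := lintegral_lintegral_swap (μ := (volume : Measure V))
          (ν := (volume : Measure V).toSphere)
          (f := fun (x : V) (u : Metric.sphere (0 : V) 1) =>
            ENNReal.ofReal (2 ^ (-(2 * s)) / (2 * s)) *
              (B.indicator (fun x => ENNReal.ofReal (|inner ℝ x (u : V)| ^ (-(2 * s)))) x))
          (Measurable.aemeasurable (Measurable.mul measurable_const mJ))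
        rw [hsw]
        simp only [lintegral_const_mul' _ _ ENNReal.ofReal_ne_top, lintegral_indicator hB]
        rw [← mul_assoc]
        congr 1
        rw [show (2 : ℝ≥0∞) = ENNReal.ofReal 2 by simp, ← ENNReal.ofReal_mul (by norm_num)]
        congr 1
        field_simp
    _ ≤ 2 * ∫⁻ x, ∫⁻ h, F h x := by
        gcongr with x
        exact step2 x

end BallEnergy

lemma energy_ball_ge {N : ℕ} (hN : 0 < N) {s : ℝ} (hs : 0 < s) (hs' : s < 1 / 2) {ρ : ℝ}
    (hρ : 0 < ρ) :
    ENNReal.ofReal (2 ^ (-(2 * s)) / s) * (ENNReal.ofReal (ρ ^ ((N : ℝ) - 2 * s) *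
      (Gamma (1 / 2 - s) * √π ^ (N - 1) / Gamma ((N : ℝ) / 2 + 1 - s))) *
      (N * volume (Metric.ball (0 : EuclideanSpace ℝ (Fin N)) 1))) ≤
    energy ((N : ℝ) + 2 * s) (Metric.ball (0 : EuclideanSpace ℝ (Fin N)) ρ) := by
  have : Nonempty (Fin N) := ⟨⟨0, hN⟩⟩
  have h := energy_ge (V := EuclideanSpace ℝ (Fin N)) hs
    (Metric.isOpen_ball (x := 0) (ε := ρ)).measurableSet measure_ball_lt_top.ne
  rw [finrank_euclideanSpace_fin] at h
  refine le_trans (le_of_eq ?_) h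
  congr 1
  have e : ∀ u : Metric.sphere (0 : EuclideanSpace ℝ (Fin N)) 1,
      ∫⁻ x in Metric.ball (0 : EuclideanSpace ℝ (Fin N)) ρ,
        ENNReal.ofReal (|inner ℝ x (u : EuclideanSpace ℝ (Fin N))| ^ (-(2 * s))) =
      ENNReal.ofReal (ρ ^ ((N : ℝ) - 2 * s) *
      (Gamma (1 / 2 - s) * √π ^ (N - 1) / Gamma ((N : ℝ) / 2 + 1 - s))) := fun u =>
    bmom_eq hN hs' (by simp) hρ
  simp only [e]
  rw [lintegral_const, Measure.toSphere_apply_univ, finrank_euclideanSpace_fin]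

lemma fracPerimeter_eq_energy {N : ℕ} {s : ℝ}
    {E : Set (EuclideanSpace ℝ (Fin N))} (hE : MeasurableSet E) :
    fracPerimeter N s E = energy ((N : ℝ) + 2 * s) E := by
  unfold fracPerimeter energy
  have hm : Measurable fun z : EuclideanSpace ℝ (Fin N) × EuclideanSpace ℝ (Fin N) =>
      kern ((N : ℝ) + 2 * s) z.1 z.2 * dis E z.1 z.2 :=
    (measurable_kern _).mul (measurable_dis hE)
  rw [lintegral_prod _ hm.aemeasurable]
  refine lintegral_congr fun x => lintegral_congr fun y => ?_
  have key : ∀ x y : EuclideanSpace ℝ (Fin N), x ≠ y →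
      ENNReal.ofReal (1 / ‖x - y‖ ^ ((N : ℝ) + 2 * s)) = kern ((N : ℝ) + 2 * s) x y := by
    intro x y hxy
    have : 0 < ‖x - y‖ := norm_pos_iff.2 (sub_ne_zero.2 hxy)
    rw [kern, ENNReal.ofReal_rpow_of_pos this, Real.rpow_neg this.le, one_div]
  by_cases c1 : x ∈ E <;> by_cases c2 : y ∈ E
  · simp [dis, c1, c2]
  · have hne : x ≠ y := fun h => c2 (h ▸ c1)
    rw [← key x y hne]
    simp [dis, c1, c2]
  · have hne : x ≠ y := fun h => c1 (h ▸ c2)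
    rw [← key x y hne]
    simp [dis, c1, c2]
  · simp [dis, c1, c2]

/-- The real identity between the two forms of the constant. -/
lemma const_identity {N : ℕ} (hN : 0 < N) {s : ℝ} (hs : 0 < s) (hs' : s < 1 / 2) {ρ : ℝ}
    (hρ : 0 < ρ) :
    (N * π ^ ((N : ℝ) / 2 + s) * Gamma (1 - 2 * s)
          / (s * Gamma ((N : ℝ) / 2 + 1) ^ (2 * s / (N : ℝ)) * Gamma (1 - s)
              * Gamma (((N : ℝ) + 2 - 2 * s) / 2))) *
      (ρ ^ N * (√π ^ N / Gamma ((N : ℝ) / 2 + 1))) ^ (((N : ℝ) - 2 * s) / N) =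
    2 ^ (-(2 * s)) / s * ((ρ ^ ((N : ℝ) - 2 * s) *
      (Gamma (1 / 2 - s) * √π ^ (N - 1) / Gamma ((N : ℝ) / 2 + 1 - s))) *
      (N * (√π ^ N / Gamma ((N : ℝ) / 2 + 1)))) := by
  have hN' : (1 : ℝ) ≤ N := by exact_mod_cast hN
  have hN0 : (N : ℝ) ≠ 0 := by positivity
  have hG1 : 0 < Gamma ((N : ℝ) / 2 + 1) := Gamma_pos_of_pos (by linarith)
  have hG2 : 0 < Gamma ((N : ℝ) / 2 + 1 - s) := Gamma_pos_of_pos (by linarith)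
  have hG3 : 0 < Gamma (1 - s) := Gamma_pos_of_pos (by linarith)
  have dup := Real.Gamma_mul_Gamma_add_half (1 / 2 - s)
  rw [show 1 / 2 - s + 1 / 2 = 1 - s by ring, show 2 * (1 / 2 - s) = 1 - 2 * s by ring,
    show 1 - (1 - 2 * s) = 2 * s by ring] at dup
  rw [show ((N : ℝ) + 2 - 2 * s) / 2 = (N : ℝ) / 2 + 1 - s by ring]
  have e1 : (ρ ^ N * (√π ^ N / Gamma ((N : ℝ) / 2 + 1))) ^ (((N : ℝ) - 2 * s) / N) =
      ρ ^ ((N : ℝ) - 2 * s) * (√π ^ N / Gamma ((N : ℝ) / 2 + 1)) *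
        (Gamma ((N : ℝ) / 2 + 1) ^ (2 * s / (N : ℝ)) / π ^ s) := by
    rw [Real.mul_rpow (by positivity) (by positivity), ← Real.rpow_natCast ρ, ← Real.rpow_mul hρ.le,
      mul_div_cancel₀ _ hN0, mul_assoc]
    congr 1
    rw [sub_div, div_self hN0, Real.rpow_sub (by positivity), Real.rpow_one,
      Real.div_rpow (by positivity) hG1.le, ← Real.rpow_natCast (√π), ← Real.rpow_mul (by positivity),
      mul_div_cancel₀ _ hN0, show (√π) ^ (2 * s) = π ^ s by
        rw [Real.sqrt_eq_rpow, ← Real.rpow_mul pi_pos.le]; congr 1; ring]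
    field_simp
  have e2 : π ^ ((N : ℝ) / 2 + s) = √π ^ (N - 1) * √π * π ^ s := by
    rw [Real.rpow_add pi_pos, ← pow_succ, Nat.sub_add_cancel hN, Real.sqrt_eq_rpow,
      ← Real.rpow_natCast, ← Real.rpow_mul pi_pos.le]
    congr 2
    ring
  have e3 : (2 : ℝ) ^ (-(2 * s)) = (2 ^ (2 * s))⁻¹ := Real.rpow_neg (by norm_num) _
  have e4 : Gamma (1 / 2 - s) = Gamma (1 - 2 * s) * 2 ^ (2 * s) * √π / Gamma (1 - s) := by
    rw [← dup]; field_simp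
  rw [e1, e2, e3, e4]
  have p1 : 0 < π ^ s := by positivity
  have p2 : 0 < (2 : ℝ) ^ (2 * s) := by positivity
  have p3 : 0 < Gamma ((N : ℝ) / 2 + 1) ^ (2 * s / (N : ℝ)) := by positivity
  generalize Gamma ((N : ℝ) / 2 + 1) ^ (2 * s / (N : ℝ)) = X at *
  generalize π ^ s = Y at *
  generalize (2 : ℝ) ^ (2 * s) = Z at *
  generalize √π ^ (N - 1) = W at *
  generalize √π ^ N = W' at *
  generalize ρ ^ ((N : ℝ) - 2 * s) = R at *
  field_simp

theorem fracPerimeter_isoperimetric_inequality (N : ℕ) (hN : 2 ≤ N)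
    (s : ℝ) (hs : 0 < s) (hs' : s < 1 / 2)
    (E : Set (EuclideanSpace ℝ (Fin N))) (hE : MeasurableSet E) (hEvol : volume E < ⊤) :
    ENNReal.ofReal
        (N * π ^ ((N : ℝ) / 2 + s) * Gamma (1 - 2 * s)
          / (s * Gamma ((N : ℝ) / 2 + 1) ^ (2 * s / (N : ℝ)) * Gamma (1 - s)
              * Gamma (((N : ℝ) + 2 - 2 * s) / 2)))
      * (volume E) ^ (((N : ℝ) - 2 * s) / N)
    ≤ fracPerimeter N s E := by
  have hN0 : 0 < N := by lia
  have hN1 : (2 : ℝ) ≤ N := by exact_mod_cast hN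
  have hNr : (0 : ℝ) < N := by linarith
  have hex : 0 < ((N : ℝ) - 2 * s) / N := div_pos (by linarith) hNr
  have : Nonempty (Fin N) := ⟨⟨0, hN0⟩⟩
  have hG1 : 0 < Gamma ((N : ℝ) / 2 + 1) := Gamma_pos_of_pos (by linarith)
  have hG2 : 0 < Gamma ((N : ℝ) / 2 + 1 - s) := Gamma_pos_of_pos (by linarith)
  have hG3 : 0 < Gamma (1 - s) := Gamma_pos_of_pos (by linarith)
  have hG4 : 0 < Gamma (1 - 2 * s) := Gamma_pos_of_pos (by linarith)
  have hG5 : 0 < Gamma (1 / 2 - s) := Gamma_pos_of_pos (by linarith)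
  have hG6 : 0 < Gamma (((N : ℝ) + 2 - 2 * s) / 2) := Gamma_pos_of_pos (by linarith)
  rcases eq_or_ne (volume E) 0 with h0 | h0
  · rw [h0, ENNReal.zero_rpow_of_pos hex, mul_zero]
    exact zero_le
  set m := (volume E).toReal with hm
  have hm0 : 0 < m := ENNReal.toReal_pos h0 hEvol.ne
  set ω : ℝ := √π ^ N / Gamma ((N : ℝ) / 2 + 1) with hω
  have hω0 : 0 < ω := by positivity
  set ρ : ℝ := (m / ω) ^ (1 / (N : ℝ)) with hρdef
  have hρ : 0 < ρ := by positivity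
  have hρN : ρ ^ N = m / ω := by
    rw [hρdef, ← Real.rpow_natCast, ← Real.rpow_mul (by positivity), one_div,
      inv_mul_cancel₀ hNr.ne', Real.rpow_one]
  have hvol : ∀ r : ℝ, 0 ≤ r → volume (Metric.ball (0 : EuclideanSpace ℝ (Fin N)) r) =
      ENNReal.ofReal (r ^ N * ω) := by
    intro r hr
    rw [EuclideanSpace.volume_ball, Fintype.card_fin, ENNReal.ofReal_mul (by positivity),
      ENNReal.ofReal_pow hr]
  have hEb : volume E = volume (Metric.ball (0 : EuclideanSpace ℝ (Fin N)) ρ) := by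
    rw [hvol ρ hρ.le, hρN, div_mul_cancel₀ _ hω0.ne', hm, ENNReal.ofReal_toReal hEvol.ne]
  rw [fracPerimeter_eq_energy hE]
  refine le_trans (le_trans (le_of_eq ?_) (energy_ball_ge hN0 hs hs' hρ))
    (energy_ball_le (by positivity) hE hEb)
  rw [hEb, hvol ρ hρ.le, hvol 1 zero_le_one, one_pow, one_mul,
    ENNReal.ofReal_rpow_of_pos (by positivity), ← ENNReal.ofReal_mul (by positivity),
    ← ENNReal.ofReal_natCast N, ← ENNReal.ofReal_mul (by positivity),
    ← ENNReal.ofReal_mul (by positivity), ← ENNReal.ofReal_mul (by positivity)]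
  congr 1
  exact const_identity hN0 hs hs' hρ
end

section
/- Let N ≥ 2, 0 < s < 1, and let ξ ∈ ℝ^N. Then ∫_{ℝ^N} (1 - cos(2π⟨h,ξ⟩)) / |h|^(N+2s) dh = ( π^(N/2) · Γ(1-s) / ( s · 2^(2s) · Γ((N+2s)/2) ) ) · (2π|ξ|)^(2s). -/
open MeasureTheory Real
open scoped ENNReal RealInnerProductSpace

lemma aux_A {a r : ℝ} (ha : 0 < a) (hr : 0 < r) :
    ∫⁻ t in Set.Ioi (0 : ℝ), ENNReal.ofReal (t ^ (a - 1) * exp (-(r * t)))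
      = ENNReal.ofReal ((1 / r) ^ a * Gamma a) := by
  have h := integral_rpow_mul_exp_neg_mul_Ioi ha hr
  have hpos : 0 < (1 / r) ^ a * Gamma a := mul_pos (by positivity) (Gamma_pos_of_pos ha)
  rw [← h, ofReal_integral_eq_lintegral_ofReal]
  · by_contra hc
    rw [integral_undef hc] at h
    linarith
  · filter_upwards [ae_restrict_mem measurableSet_Ioi] with t ht
    have : 0 < t := ht
    simp only [Pi.zero_apply]
    positivity

lemma aux_C {s u : ℝ} (hs' : s < 1) (hu : 0 < u) :
    ∫⁻ t in Set.Ioi (0 : ℝ), ENNReal.ofReal (t ^ (s - 2) * exp (-(u / t)))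
      = ENNReal.ofReal (Gamma (1 - s) * u ^ (s - 1)) := by
  have h1 := integral_rpow_mul_exp_neg_mul_Ioi (a := 1 - s) (by linarith) hu
  rw [← integral_comp_rpow_Ioi _ (p := -1) (by norm_num)] at h1
  have h : ∫ t in Set.Ioi (0 : ℝ), t ^ (s - 2) * exp (-(u / t)) = Gamma (1 - s) * u ^ (s - 1) := by
    rw [mul_comm (Gamma _), one_div, inv_rpow hu.le, ← rpow_neg hu.le, neg_sub] at *
    rw [← h1]
    refine setIntegral_congr_fun measurableSet_Ioi fun t ht => ?_
    have ht : 0 < t := ht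
    simp only [abs_neg, abs_one, one_mul, smul_eq_mul]
    rw [← rpow_mul ht.le, ← mul_assoc, ← rpow_add ht, rpow_neg_one, div_eq_mul_inv]
    congr 2
    ring
  have hpos : 0 < Gamma (1 - s) * u ^ (s - 1) :=
    mul_pos (Gamma_pos_of_pos (by linarith)) (by positivity)
  rw [← h, ofReal_integral_eq_lintegral_ofReal]
  · by_contra hc
    rw [integral_undef hc] at h
    linarith
  · filter_upwards [ae_restrict_mem measurableSet_Ioi] with t ht
    have : 0 < t := ht
    simp only [Pi.zero_apply]
    positivity

lemma aux_D {t c : ℝ} (ht : 0 < t) (hc : 0 ≤ c) :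
    ∫⁻ u in Set.Ioc (0 : ℝ) c, ENNReal.ofReal (t⁻¹ * exp (-(u / t)))
      = ENNReal.ofReal (1 - exp (-(c / t))) := by
  have h : ∫ u in (0 : ℝ)..c, t⁻¹ * exp (-(u / t)) = 1 - exp (-(c / t)) := by
    rw [intervalIntegral.integral_eq_sub_of_hasDerivAt (f := fun u => - exp (-(u / t)))]
    · simp; ring
    · intro u _
      have := (((hasDerivAt_id u).div_const t).neg.exp).neg
      refine HasDerivAt.congr_deriv (f := fun u => - exp (-(u / t))) this ?_
      simp [div_eq_mul_inv, mul_comm]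
    · apply Continuous.intervalIntegrable; fun_prop
  rw [← h, intervalIntegral.integral_of_le hc, ofReal_integral_eq_lintegral_ofReal]
  · apply Continuous.integrableOn_Ioc; fun_prop
  · filter_upwards with u
    simp only [Pi.zero_apply]
    positivity

lemma aux_E {s c : ℝ} (hs : 0 < s) (hc : 0 ≤ c) :
    ∫⁻ u in Set.Ioc (0 : ℝ) c, ENNReal.ofReal (u ^ (s - 1)) = ENNReal.ofReal (c ^ s / s) := by
  have h : ∫ u in (0 : ℝ)..c, u ^ (s - 1) = c ^ s / s := by
    rw [integral_rpow (Or.inl (by linarith))]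
    simp [zero_rpow hs.ne']
  rw [← h, intervalIntegral.integral_of_le hc, ofReal_integral_eq_lintegral_ofReal]
  · exact (intervalIntegrable_iff_integrableOn_Ioc_of_le hc).1
      (intervalIntegral.intervalIntegrable_rpow' (by linarith))
  · filter_upwards [ae_restrict_mem measurableSet_Ioc] with t ht
    have : 0 < t := ht.1
    simp only [Pi.zero_apply]
    positivity

lemma aux_F {s c : ℝ} (hs : 0 < s) (hs' : s < 1) (hc : 0 ≤ c) :
    ∫⁻ t in Set.Ioi (0 : ℝ), ENNReal.ofReal (t ^ (s - 1) * (1 - exp (-(c / t))))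
      = ENNReal.ofReal (Gamma (1 - s) * (c ^ s / s)) := by
  have hG : 0 ≤ Gamma (1 - s) := (Gamma_pos_of_pos (by linarith)).le
  calc _ = ∫⁻ t in Set.Ioi (0 : ℝ), ∫⁻ u in Set.Ioc (0 : ℝ) c,
        ENNReal.ofReal (t ^ (s - 2) * exp (-(u / t))) := by
        refine setLIntegral_congr_fun measurableSet_Ioi fun t ht => ?_
        have ht : 0 < t := ht
        rw [ENNReal.ofReal_mul (by positivity), ← aux_D ht hc, ← lintegral_const_mul _ (by fun_prop)]
        refine lintegral_congr fun u => ?_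
        rw [← ENNReal.ofReal_mul (by positivity), ← mul_assoc, ← rpow_neg_one, ← rpow_add ht]
        congr 3
        ring
    _ = ∫⁻ u in Set.Ioc (0 : ℝ) c, ∫⁻ t in Set.Ioi (0 : ℝ),
        ENNReal.ofReal (t ^ (s - 2) * exp (-(u / t))) := by
        rw [lintegral_lintegral_swap]
        apply Measurable.aemeasurable
        unfold Function.uncurry
        fun_prop
    _ = ∫⁻ u in Set.Ioc (0 : ℝ) c, ENNReal.ofReal (Gamma (1 - s)) * ENNReal.ofReal (u ^ (s - 1)) := by
        refine setLIntegral_congr_fun measurableSet_Ioc fun u hu => ?_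
        rw [aux_C hs' hu.1, ENNReal.ofReal_mul hG]
    _ = _ := by
        rw [lintegral_const_mul _ (by fun_prop), aux_E hs hc, ENNReal.ofReal_mul hG]

lemma aux_B (N : ℕ) (ξ : EuclideanSpace ℝ (Fin N)) {t : ℝ} (ht : 0 < t) :
    ∫⁻ h : EuclideanSpace ℝ (Fin N),
        ENNReal.ofReal ((1 - cos (2 * π * ⟪h, ξ⟫)) * exp (-(‖h‖ ^ 2 * t)))
    = ENNReal.ofReal ((π / t) ^ ((N : ℝ) / 2) * (1 - exp (-(π ^ 2 * ‖ξ‖ ^ 2 / t)))) := by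
  have key : ∀ w : EuclideanSpace ℝ (Fin N),
      Integrable (fun h : EuclideanSpace ℝ (Fin N) => cos (2 * π * ⟪h, w⟫) * exp (-(‖h‖ ^ 2 * t))) ∧
      ∫ h : EuclideanSpace ℝ (Fin N), cos (2 * π * ⟪h, w⟫) * exp (-(‖h‖ ^ 2 * t))
        = (π / t) ^ ((N : ℝ) / 2) * exp (-(π ^ 2 * ‖w‖ ^ 2 / t)) := by
    intro w
    have h := GaussianFourier.integral_cexp_neg_mul_sq_norm_add_of_euclideanSpace
      (b := (t : ℂ)) (by simpa using ht) (2 * π * Complex.I) w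
    have e : ((π / t : ℂ)) ^ ((Fintype.card (Fin N) : ℂ) / 2) *
        Complex.exp ((2 * π * Complex.I) ^ 2 * ‖w‖ ^ 2 / (4 * t))
        = (((π / t) ^ ((N : ℝ) / 2) * exp (-(π ^ 2 * ‖w‖ ^ 2 / t)) : ℝ) : ℂ) := by
      push_cast
      rw [Complex.ofReal_cpow (by positivity)]
      push_cast
      rw [Fintype.card_fin]
      congr 2
      rw [mul_pow, Complex.I_sq]
      have : (t : ℂ) ≠ 0 := by exact_mod_cast ht.ne'
      field_simp
      ring
    rw [e] at h
    have hpos : 0 < (π / t) ^ ((N : ℝ) / 2) * exp (-(π ^ 2 * ‖w‖ ^ 2 / t)) := by positivity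
    have hI : Integrable (fun v : EuclideanSpace ℝ (Fin N) =>
        Complex.exp (-(t : ℂ) * ‖v‖ ^ 2 + 2 * π * Complex.I * ⟪w, v⟫)) := by
      by_contra hc
      rw [integral_undef hc] at h
      exact hpos.ne (by exact_mod_cast h)
    have e2 : ∀ v : EuclideanSpace ℝ (Fin N), RCLike.re
        (Complex.exp (-(t : ℂ) * ‖v‖ ^ 2 + 2 * π * Complex.I * ⟪w, v⟫))
        = cos (2 * π * ⟪v, w⟫) * exp (-(‖v‖ ^ 2 * t)) := by
      intro v
      have : (-(t : ℂ) * ‖v‖ ^ 2 + 2 * π * Complex.I * ⟪w, v⟫)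
        = ((-(‖v‖ ^ 2 * t) : ℝ) : ℂ) + ((2 * π * ⟪v, w⟫ : ℝ) : ℂ) * Complex.I := by
        rw [real_inner_comm]
        push_cast
        ring
      rw [this]
      change (Complex.exp _).re = _
      rw [Complex.exp_re, mul_comm]
      simp only [Complex.add_re, Complex.add_im, Complex.ofReal_re, Complex.ofReal_im,
        Complex.re_ofReal_mul, Complex.im_ofReal_mul, Complex.I_re, Complex.I_im,
        mul_zero, mul_one, add_zero, zero_add]
    have h3 := integral_re hI
    have h4 := hI.re
    simp_rw [e2] at h3 h4
    refine ⟨h4, ?_⟩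
    rw [h3, h]
    exact Complex.ofReal_re _
  obtain ⟨i1, v1⟩ := key ξ
  obtain ⟨i0, v0⟩ := key 0
  have hs := integral_sub i0 i1
  have hi := i0.sub i1
  rw [v0, v1] at hs
  have e : ∀ h : EuclideanSpace ℝ (Fin N), (1 - cos (2 * π * ⟪h, ξ⟫)) * exp (-(‖h‖ ^ 2 * t))
    = cos (2 * π * ⟪h, (0 : EuclideanSpace ℝ (Fin N))⟫) * exp (-(‖h‖ ^ 2 * t))
      - cos (2 * π * ⟪h, ξ⟫) * exp (-(‖h‖ ^ 2 * t)) := by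
    intro h
    rw [inner_zero_right, mul_zero, cos_zero]
    ring
  have e' : (π / t) ^ ((N : ℝ) / 2) * (1 - exp (-(π ^ 2 * ‖ξ‖ ^ 2 / t))) =
     (π / t) ^ ((N : ℝ) / 2) * exp (-(π ^ 2 * ‖(0 : EuclideanSpace ℝ (Fin N))‖ ^ 2 / t))
      - (π / t) ^ ((N : ℝ) / 2) * exp (-(π ^ 2 * ‖ξ‖ ^ 2 / t)) := by
    simp
    ring
  rw [e', ← hs, ofReal_integral_eq_lintegral_ofReal]
  · simp_rw [e]
  · exact hi
  · filter_upwards with h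
    rw [← e h]
    exact mul_nonneg (by linarith [cos_le_one (2 * π * ⟪h, ξ⟫)]) (by positivity)

theorem integral_one_sub_cos_inner (N : ℕ) (hN : 2 ≤ N) (s : ℝ) (hs : 0 < s) (hs' : s < 1)
    (ξ : EuclideanSpace ℝ (Fin N)) :
    ∫⁻ h : EuclideanSpace ℝ (Fin N),
        ENNReal.ofReal ((1 - Real.cos (2 * π * ⟪h, ξ⟫)) / ‖h‖ ^ ((N : ℝ) + 2 * s))
    = ENNReal.ofReal
        ((π ^ ((N : ℝ) / 2) * Gamma (1 - s) / (s * 2 ^ (2 * s) * Gamma (((N : ℝ) + 2 * s) / 2)))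
          * (2 * π * ‖ξ‖) ^ (2 * s)) := by
  have : Nonempty (Fin N) := ⟨⟨0, by omega⟩⟩
  set a : ℝ := ((N : ℝ) + 2 * s) / 2 with ha_def
  have ha : 0 < a := by positivity
  have hG : 0 < Gamma a := Gamma_pos_of_pos ha
  have hG' : 0 < Gamma (1 - s) := Gamma_pos_of_pos (by linarith)
  have hcos : ∀ h : EuclideanSpace ℝ (Fin N), 0 ≤ 1 - cos (2 * π * ⟪h, ξ⟫) := fun h => by
    linarith [cos_le_one (2 * π * ⟪h, ξ⟫)]
  have step1 : ∫⁻ h : EuclideanSpace ℝ (Fin N),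
        ENNReal.ofReal ((1 - Real.cos (2 * π * ⟪h, ξ⟫)) / ‖h‖ ^ ((N : ℝ) + 2 * s))
      = ∫⁻ h : EuclideanSpace ℝ (Fin N), ENNReal.ofReal (Gamma a)⁻¹ *
        ∫⁻ t in Set.Ioi (0 : ℝ), ENNReal.ofReal
          (t ^ (a - 1) * ((1 - cos (2 * π * ⟪h, ξ⟫)) * exp (-(‖h‖ ^ 2 * t)))) := by
    refine lintegral_congr fun h => ?_
    by_cases h0 : h = 0
    · simp [h0]
    have hn : 0 < ‖h‖ := norm_pos_iff.2 h0
    have : ∀ t : ℝ, ENNReal.ofReal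
          (t ^ (a - 1) * ((1 - cos (2 * π * ⟪h, ξ⟫)) * exp (-(‖h‖ ^ 2 * t))))
        = ENNReal.ofReal (1 - cos (2 * π * ⟪h, ξ⟫)) *
          ENNReal.ofReal (t ^ (a - 1) * exp (-(‖h‖ ^ 2 * t))) := fun t => by
      rw [← ENNReal.ofReal_mul (hcos h)]
      congr 1
      ring
    simp_rw [this]
    rw [lintegral_const_mul _ (by fun_prop), aux_A ha (by positivity),
      ← ENNReal.ofReal_mul (hcos h), ← ENNReal.ofReal_mul (by positivity)]
    congr 1
    rw [one_div, inv_rpow (by positivity), ← rpow_natCast ‖h‖ 2, ← rpow_mul hn.le]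
    have : ((2 : ℕ) : ℝ) * a = (N : ℝ) + 2 * s := by rw [ha_def]; push_cast; ring
    rw [this]
    field_simp
  have step2 : ∫⁻ h : EuclideanSpace ℝ (Fin N),
        ∫⁻ t in Set.Ioi (0 : ℝ), ENNReal.ofReal
          (t ^ (a - 1) * ((1 - cos (2 * π * ⟪h, ξ⟫)) * exp (-(‖h‖ ^ 2 * t))))
      = ENNReal.ofReal (π ^ ((N : ℝ) / 2)) *
        ENNReal.ofReal (Gamma (1 - s) * ((π ^ 2 * ‖ξ‖ ^ 2) ^ s / s)) := by
    rw [lintegral_lintegral_swap, ← aux_F hs hs' (by positivity), ← lintegral_const_mul _ (by fun_prop)]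
    · refine setLIntegral_congr_fun measurableSet_Ioi fun t ht => ?_
      have ht : 0 < t := ht
      have : ∀ h : EuclideanSpace ℝ (Fin N), ENNReal.ofReal
          (t ^ (a - 1) * ((1 - cos (2 * π * ⟪h, ξ⟫)) * exp (-(‖h‖ ^ 2 * t))))
        = ENNReal.ofReal (t ^ (a - 1)) *
          ENNReal.ofReal ((1 - cos (2 * π * ⟪h, ξ⟫)) * exp (-(‖h‖ ^ 2 * t))) := fun h =>
        ENNReal.ofReal_mul (by positivity)
      simp_rw [this]
      rw [lintegral_const_mul _ (by fun_prop), aux_B N ξ ht, ← ENNReal.ofReal_mul (by positivity),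
        ← ENNReal.ofReal_mul (by positivity), div_rpow pi_pos.le ht.le]
      congr 1
      have : t ^ (a - 1) = t ^ (s - 1) * t ^ ((N : ℝ) / 2) := by
        rw [← rpow_add ht]
        congr 1
        rw [ha_def]
        ring
      rw [this]
      field_simp
    · apply Measurable.aemeasurable
      unfold Function.uncurry
      fun_prop
  rw [step1, lintegral_const_mul', step2, ← ENNReal.ofReal_mul (by positivity),
    ← ENNReal.ofReal_mul (by positivity)]
  · congr 1
    have h1 : (2 * π * ‖ξ‖) ^ (2 * s) = 2 ^ (2 * s) * (π ^ 2 * ‖ξ‖ ^ 2) ^ s := by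
      rw [mul_assoc, mul_rpow (by positivity) (by positivity), rpow_mul (x := π * ‖ξ‖) (by positivity),
        rpow_two, mul_pow]
    rw [h1]
    field_simp
  · exact ENNReal.ofReal_ne_top
end

section
/- Let N ≥ 2 and 0 < s < 1. Then ∫_{ℝ^N} (1 - cos(h_N)) / |h|^(N+2s) dh = π^(N/2) · Γ(1-s) / ( s · 2^(2s) · Γ((N+2s)/2) ), where h_N denotes the last coordinate of h ∈ ℝ^N. -/
open MeasureTheory Real
open scoped ENNReal

lemma lint_of_int {α : Type*} [MeasurableSpace α] {μ : Measure α} {f : α → ℝ} {c : ℝ}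
    (hf : 0 ≤ᵐ[μ] f) (h : ∫ x, f x ∂μ = c) (hc : c ≠ 0) :
    ∫⁻ x, ENNReal.ofReal (f x) ∂μ = ENNReal.ofReal c := by
  have hi : Integrable f μ := by
    by_contra hn
    exact hc (by rw [← h, integral_undef hn])
  rw [← ofReal_integral_eq_lintegral_ofReal hi hf, h]

lemma lint_gamma {a r : ℝ} (ha : 0 < a) (hr : 0 < r) :
    ∫⁻ t in Set.Ioi (0:ℝ), ENNReal.ofReal (t ^ (a - 1) * exp (-(r * t)))
      = ENNReal.ofReal ((1 / r) ^ a * Gamma a) := by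
  apply lint_of_int _ (Real.integral_rpow_mul_exp_neg_mul_Ioi ha hr)
  · have := Gamma_pos_of_pos ha
    positivity
  · filter_upwards [ae_restrict_mem measurableSet_Ioi] with t ht
    have : (0:ℝ) < t := ht
    simp only [Pi.zero_apply]; positivity

lemma lint_invgamma {s u : ℝ} (hs : s < 1) (hu : 0 < u) :
    ∫⁻ t in Set.Ioi (0:ℝ), ENNReal.ofReal (t ^ (s - 2) * exp (-(u / t)))
      = ENNReal.ofReal (u ^ (s - 1) * Gamma (1 - s)) := by
  have h1 : 0 < 1 - s := by linarith
  apply lint_of_int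
  · filter_upwards [ae_restrict_mem measurableSet_Ioi] with t ht
    have : (0:ℝ) < t := ht
    simp only [Pi.zero_apply]; positivity
  · have h := Real.integral_rpow_mul_exp_neg_mul_Ioi h1 hu
    rw [← integral_comp_rpow_Ioi _ (show (-1:ℝ) ≠ 0 by norm_num)] at h
    have e : (1 / u) ^ (1 - s) = u ^ (s - 1) := by
      rw [one_div, Real.inv_rpow hu.le, ← Real.rpow_neg hu.le]; congr 1; ring
    rw [← e, ← h]
    apply setIntegral_congr_fun measurableSet_Ioi
    intro t ht
    have ht : (0:ℝ) < t := ht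
    simp only [smul_eq_mul, abs_neg, abs_one, one_mul]
    rw [← Real.rpow_mul ht.le, ← mul_assoc, ← Real.rpow_add ht, Real.rpow_neg_one, div_eq_mul_inv]
    congr 2; ring
  · have := Gamma_pos_of_pos h1
    positivity

lemma lint_gauss (N : ℕ) (i : Fin N) {t : ℝ} (ht : 0 < t) :
    ∫⁻ h : EuclideanSpace ℝ (Fin N), ENNReal.ofReal ((1 - Real.cos (h i)) * exp (-(t * ‖h‖ ^ 2)))
      = ENNReal.ofReal ((π / t) ^ ((N:ℝ) / 2) * (1 - exp (-(1 / 4 / t)))) := by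
  have hb : 0 < (t : ℂ).re := by simpa using ht
  have I1 := GaussianFourier.integrable_cexp_neg_mul_sq_norm_add hb Complex.I (EuclideanSpace.single i (1:ℝ))
  have I0 := GaussianFourier.integrable_cexp_neg_mul_sq_norm_add hb 0 (EuclideanSpace.single i (1:ℝ))
  have J1 := GaussianFourier.integral_cexp_neg_mul_sq_norm_add hb Complex.I (EuclideanSpace.single i (1:ℝ))
  have J0 := GaussianFourier.integral_cexp_neg_mul_sq_norm_add hb 0 (EuclideanSpace.single i (1:ℝ))
  have e : ∀ h : EuclideanSpace ℝ (Fin N), (1 - Real.cos (h i)) * exp (-(t * ‖h‖ ^ 2)) =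
     (Complex.exp (-t * ‖h‖ ^ 2 + 0 * inner ℝ (EuclideanSpace.single i (1:ℝ)) h)
      - Complex.exp (-t * ‖h‖ ^ 2 + Complex.I * inner ℝ (EuclideanSpace.single i (1:ℝ)) h)).re := by
    intro h
    have : (-t * ‖h‖ ^ 2 : ℂ) = ((-(t * ‖h‖^2) : ℝ) : ℂ) := by push_cast; ring
    rw [this]
    simp [Complex.exp_re, EuclideanSpace.inner_single_left, -Complex.ofReal_neg, -Complex.ofReal_mul, -Complex.ofReal_pow]
    ring
  have hpow : ((π : ℂ) / t) ^ ((N : ℂ) / 2) = (((π / t) ^ ((N:ℝ) / 2) : ℝ) : ℂ) := by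
    rw [Complex.ofReal_cpow (by positivity)]; push_cast; rfl
  have hval : ∫ h : EuclideanSpace ℝ (Fin N), (1 - Real.cos (h i)) * exp (-(t * ‖h‖ ^ 2)) =
     (π / t) ^ ((N:ℝ) / 2) * (1 - exp (-(1 / 4 / t))) := by
    simp_rw [e]
    have := integral_re (I0.sub I1)
    simp only [RCLike.re_to_complex, Pi.sub_apply] at this
    rw [this, integral_sub I0 I1, J0, J1]
    simp only [finrank_euclideanSpace, Fintype.card_fin]
    rw [hpow]
    have : (Complex.I ^ 2 * ((‖EuclideanSpace.single i (1:ℝ)‖ : ℝ) : ℂ) ^ 2 / (4 * t) : ℂ) = ((-(1/4/t) : ℝ) : ℂ) := by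
      simp; field_simp
    rw [this, ← Complex.ofReal_exp]
    simp [-Complex.ofReal_exp]
    ring
  apply lint_of_int _ hval
  · have : 0 < 1 - exp (-(1 / 4 / t)) := by
      rw [sub_pos, Real.exp_lt_one_iff]
      have : 0 < 1 / 4 / t := by positivity
      linarith
    positivity
  · filter_upwards with h
    have := Real.cos_le_one (h i)
    simp only [Pi.zero_apply]
    exact mul_nonneg (by linarith) (exp_pos _).le

lemma lint_u {t : ℝ} (ht : 0 < t) (s : ℝ) :
    ∫⁻ u in Set.Ioc (0:ℝ) (1/4), ENNReal.ofReal (t ^ (s - 2) * exp (-(u / t)))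
      = ENNReal.ofReal (t ^ (s - 1) * (1 - exp (-(1 / 4 / t)))) := by
  have hint : ∫ u in (0:ℝ)..(1/4), t ^ (s - 2) * exp (-(u / t)) = t ^ (s - 1) * (1 - exp (-(1 / 4 / t))) := by
    rw [intervalIntegral.integral_eq_sub_of_hasDerivAt (f := fun u => - (t ^ (s - 1) * exp (-(u / t))))]
    · simp; ring
    · intro u _
      have : HasDerivAt (fun u : ℝ => -(u / t)) (-(1 / t)) u := ((hasDerivAt_id u).div_const t).neg
      convert! ((this.exp).const_mul (t ^ (s - 1))).neg using 1
      have : t ^ (s - 1) = t ^ (s - 2) * t := by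
        rw [← Real.rpow_add_one ht.ne']; congr 1; ring
      rw [this]; field_simp
    · apply Continuous.intervalIntegrable; fun_prop
  rw [intervalIntegral.integral_of_le (by norm_num)] at hint
  apply lint_of_int _ hint
  · have : 0 < 1 - exp (-(1 / 4 / t)) := by
      rw [sub_pos, Real.exp_lt_one_iff]
      have : 0 < 1 / 4 / t := by positivity
      linarith
    positivity
  · filter_upwards with u
    simp only [Pi.zero_apply]; positivity

lemma lint_t {s : ℝ} (hs : 0 < s) (hs' : s < 1) :
    ∫⁻ t in Set.Ioi (0:ℝ), ENNReal.ofReal (t ^ (s - 1) * (1 - exp (-(1 / 4 / t))))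
      = ENNReal.ofReal ((1/4) ^ s / s * Gamma (1 - s)) := by
  have hG := Gamma_pos_of_pos (show 0 < 1 - s by linarith)
  rw [setLIntegral_congr_fun measurableSet_Ioi (fun t ht => (lint_u ht s).symm)]
  rw [lintegral_lintegral_swap (by fun_prop)]
  rw [setLIntegral_congr_fun measurableSet_Ioc (fun u hu => lint_invgamma hs' hu.1)]
  apply lint_of_int
  · filter_upwards [ae_restrict_mem measurableSet_Ioc] with u hu
    have := hu.1
    simp only [Pi.zero_apply]; positivity
  · rw [← intervalIntegral.integral_of_le (by norm_num), intervalIntegral.integral_mul_const,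
      integral_rpow (by left; linarith)]
    simp [hs.ne']
  · positivity

theorem integral_one_sub_cos_last_coord (N : ℕ) (hN : 2 ≤ N) (s : ℝ) (hs : 0 < s) (hs' : s < 1) :
    ∫⁻ h : EuclideanSpace ℝ (Fin N),
        ENNReal.ofReal ((1 - Real.cos (h ⟨N - 1, by omega⟩)) / ‖h‖ ^ ((N : ℝ) + 2 * s))
    = ENNReal.ofReal
        (π ^ ((N : ℝ) / 2) * Gamma (1 - s) / (s * 2 ^ (2 * s) * Gamma (((N : ℝ) + 2 * s) / 2))) := by
  set i : Fin N := ⟨N - 1, by omega⟩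
  set a : ℝ := ((N : ℝ) + 2 * s) / 2 with ha
  have ha0 : 0 < a := by positivity
  have hG := Gamma_pos_of_pos ha0
  have key : ∫⁻ h : EuclideanSpace ℝ (Fin N), ENNReal.ofReal (Gamma a) *
        ENNReal.ofReal ((1 - Real.cos (h i)) / ‖h‖ ^ ((N : ℝ) + 2 * s))
      = ENNReal.ofReal (π ^ ((N : ℝ) / 2) * ((1/4) ^ s / s * Gamma (1 - s))) := by
    have e : ∀ h : EuclideanSpace ℝ (Fin N), ENNReal.ofReal (Gamma a) *
        ENNReal.ofReal ((1 - Real.cos (h i)) / ‖h‖ ^ ((N : ℝ) + 2 * s)) =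
        ∫⁻ t in Set.Ioi (0:ℝ), ENNReal.ofReal (t ^ (a - 1) * ((1 - Real.cos (h i)) * exp (-(t * ‖h‖ ^ 2)))) := by
      intro h
      have hc : 0 ≤ 1 - Real.cos (h i) := by linarith [Real.cos_le_one (h i)]
      rcases eq_or_ne h 0 with rfl | hh
      · simp
      have hn : 0 < ‖h‖ := norm_pos_iff.2 hh
      have : ∀ t : ℝ, ENNReal.ofReal (t ^ (a - 1) * ((1 - Real.cos (h i)) * exp (-(t * ‖h‖ ^ 2)))) =
         ENNReal.ofReal (1 - Real.cos (h i)) * ENNReal.ofReal (t ^ (a - 1) * exp (-(‖h‖ ^ 2 * t))) := by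
        intro t
        rw [← ENNReal.ofReal_mul hc]; congr 1; rw [mul_comm t]; ring
      simp_rw [this]
      rw [lintegral_const_mul _ (by fun_prop), lint_gamma ha0 (by positivity),
        ← ENNReal.ofReal_mul hG.le, ← ENNReal.ofReal_mul hc]
      congr 1
      have : (1 / ‖h‖ ^ 2) ^ a = (‖h‖ ^ ((N : ℝ) + 2 * s))⁻¹ := by
        rw [one_div, Real.inv_rpow (by positivity), ← Real.rpow_natCast, ← Real.rpow_mul hn.le]
        congr 2; rw [ha]; push_cast; ring
      rw [this]; ring
    simp_rw [e]
    rw [lintegral_lintegral_swap (by fun_prop)]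
    have e2 : ∀ t ∈ Set.Ioi (0:ℝ), ∫⁻ h : EuclideanSpace ℝ (Fin N),
        ENNReal.ofReal (t ^ (a - 1) * ((1 - Real.cos (h i)) * exp (-(t * ‖h‖ ^ 2)))) =
        ENNReal.ofReal (π ^ ((N : ℝ) / 2)) * ENNReal.ofReal (t ^ (s - 1) * (1 - exp (-(1 / 4 / t)))) := by
      intro t ht
      have ht : 0 < t := ht
      have h1 : 0 ≤ t ^ (a - 1) := by positivity
      simp_rw [ENNReal.ofReal_mul h1]
      rw [lintegral_const_mul _ (by fun_prop), lint_gauss N i ht, ← ENNReal.ofReal_mul h1,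
        ← ENNReal.ofReal_mul (by positivity)]
      congr 1
      rw [Real.div_rpow pi_pos.le ht.le]
      have : t ^ (a - 1) = t ^ (s - 1) * t ^ ((N:ℝ)/2) := by
        rw [← Real.rpow_add ht]; congr 1; rw [ha]; ring
      rw [this]
      field_simp
    rw [setLIntegral_congr_fun measurableSet_Ioi e2, lintegral_const_mul _ (by fun_prop), lint_t hs hs',
      ← ENNReal.ofReal_mul (by positivity)]
  rw [lintegral_const_mul _ (by fun_prop)] at key
  have hne : ENNReal.ofReal (Gamma a) ≠ 0 := by simpa using hG
  rw [← ENNReal.mul_right_inj hne ENNReal.ofReal_ne_top, key, ← ENNReal.ofReal_mul hG.le]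
  congr 1
  have : (2:ℝ) ^ (2 * s) = 4 ^ s := by
    rw [Real.rpow_mul (by norm_num)]; norm_num
  rw [this, one_div, Real.inv_rpow (by norm_num)]
  field_simp
end
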